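/- Under conditions (H1) (f continuous with linear growth, g α-Hölder with α ∈ (p−1,1]), for càdlàg a with bounded variation, càdlàg z with bounded p-variation, càdlàg barrier l with x₀ ≥ l₀, there exists at least one solution (x,k) ∈ D(ℝ₊,ℝᵈ) × D(ℝ₊,ℝᵈ) of the constrained equation x_t = x₀ + ∫₀ᵗ f(x_{s−}) da_s + ∫₀ᵗ g(x_{s−}) dz_s + k_t with (x,k) = SP_l(y) and V_p(x)_T < ∞ for all T, obtained as a limit point in the Skorokhod J₁ topology of the explicit Euler-type scheme x^n_{(k+1)/n} = max(x^n_{k/n} + f(x^n_{k/n})(a_{(k+1)/n} − a_{k/n}) + g(x^n_{k/n})(z_{(k+1)/n} − z_{k/n}), l_{(k+1)/n}). -/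

import Mathlib

open Set Filter Function MeasureTheory

noncomputable section

abbrev Eu (d : ℕ) := EuclideanSpace ℝ (Fin d)

def varSums {E : Type*} [NormedAddCommGroup E] (p : ℝ) (x : ℝ → E) (a b : ℝ) : Set ℝ :=
  {v | ∃ (n : ℕ) (t : Fin (n + 1) → ℝ), Monotone t ∧ t 0 = a ∧ t (Fin.last n) = b ∧
    v = ∑ i : Fin n, ‖x (t i.succ) - x (t i.castSucc)‖ ^ p}

/-- p-variation `v_p(x)_{[a,b]}` (supremum over partitions of `[a,b]`). -/
def vpvar {E : Type*} [NormedAddCommGroup E] (p : ℝ) (x : ℝ → E) (a b : ℝ) : ℝ :=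
  sSup (varSums p x a b)

/-- `x` has finite p-variation on `[a,b]`. -/
def HasFinVar {E : Type*} [NormedAddCommGroup E] (p : ℝ) (x : ℝ → E) (a b : ℝ) : Prop :=
  BddAbove (varSums p x a b)

/-- `V_p(x)_{[a,b]} = (v_p(x)_{[a,b]})^{1/p}`. -/
def Vp {E : Type*} [NormedAddCommGroup E] (p : ℝ) (x : ℝ → E) (a b : ℝ) : ℝ :=
  vpvar p x a b ^ (1 / p)

/-- p-variation norm `V̄_p(x)_{[a,b]} = V_p(x)_{[a,b]} + ‖x a‖`. -/
def VpNorm {E : Type*} [NormedAddCommGroup E] (p : ℝ) (x : ℝ → E) (a b : ℝ) : ℝ :=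
  Vp p x a b + ‖x a‖

/-- càdlàg : right-continuous with left limits. -/
def Cadlag {E : Type*} [NormedAddCommGroup E] (x : ℝ → E) : Prop :=
  (∀ t : ℝ, ContinuousWithinAt x (Ici t) t) ∧
  ∀ t : ℝ, ∃ c : E, Tendsto x (nhdsWithin t (Iio t)) (nhds c)
/-- Solution of the d-dimensional Skorokhod problem with time dependent lower barrier `l`:
`x = y + k ≥ l` componentwise, `k 0 = 0`, each `kⁱ` nondecreasing and `kⁱ` increases
only when `xⁱ = lⁱ` (i.e. `∫ (xⁱ - lⁱ) dkⁱ = 0`). -/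
def IsSP (d : ℕ) (y l x k : ℝ → Eu d) : Prop :=
  (∀ t : ℝ, 0 ≤ t → x t = y t + k t) ∧
  (∀ t : ℝ, 0 ≤ t → ∀ i : Fin d, l t i ≤ x t i) ∧
  k 0 = 0 ∧
  (∀ i : Fin d, MonotoneOn (fun t => k t i) (Ici 0)) ∧
  ∀ (i : Fin d) (a b : ℝ), 0 ≤ a → a ≤ b →
    (∀ u ∈ Icc a b, l u i < x u i) → k a i = k b i
/-- `I` is the Riemann–Stieltjes integral `∫_a^b B(x_s, dz_s)` : limit of left-point
Riemann–Stieltjes sums as the mesh of the partition tends to `0`. -/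
def IsRSInt {M Z F : Type*} [NormedAddCommGroup M] [NormedAddCommGroup Z]
    [NormedAddCommGroup F] (B : M → Z → F) (x : ℝ → M) (z : ℝ → Z)
    (a b : ℝ) (I : F) : Prop :=
  ∀ ε : ℝ, 0 < ε → ∃ δ : ℝ, 0 < δ ∧ ∀ (n : ℕ) (t : Fin (n + 1) → ℝ),
    Monotone t → t 0 = a → t (Fin.last n) = b →
    (∀ i : Fin n, t i.succ - t i.castSucc ≤ δ) →
    ‖(∑ i : Fin n, B (x (t i.castSucc)) (z (t i.succ) - z (t i.castSucc))) - I‖ < ε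
/-- `(x, k)` is a solution of the constrained integral equation
`x_t = x₀ + ∫₀ᵗ f(x_{s-}) da_s + ∫₀ᵗ g(x_{s-}) dz_s + k_t`, i.e. `x` has finite
p-variation on compacts and `(x, k) = SP_l(y)` where `y` is `x₀` plus the two
Riemann–Stieltjes (Young) integrals. -/
def IsSolution (d : ℕ) (p : ℝ) (f : Eu d → Eu d) (g : Eu d → (Eu d →L[ℝ] Eu d))
    (a : ℝ → ℝ) (z l : ℝ → Eu d) (x0 : Eu d) (x k : ℝ → Eu d) : Prop :=
  (∀ T : ℝ, 0 ≤ T → HasFinVar p x 0 T) ∧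
  ∃ If Ig : ℝ → Eu d, If 0 = 0 ∧ Ig 0 = 0 ∧
    (∀ t : ℝ, 0 ≤ t →
      IsRSInt (fun (v : Eu d) (r : ℝ) => r • v) (fun s => f (x s)) a 0 t (If t)) ∧
    (∀ t : ℝ, 0 ≤ t →
      IsRSInt (fun (A : Eu d →L[ℝ] Eu d) (v : Eu d) => A v) (fun s => g (x s)) z 0 t (Ig t)) ∧
    IsSP d (fun t => x0 + If t + Ig t) l x k
/-- Convergence in the Skorokhod `J₁` topology on `D([0,∞), E)`, via the standard
time–change characterization: there are increasing homeomorphisms `lam n` of `ℝ₊`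
with `lam n → id` and `x n ∘ lam n → x` locally uniformly. -/
def J1Tendsto {E : Type*} [NormedAddCommGroup E] (x : ℕ → ℝ → E) (x₀ : ℝ → E) : Prop :=
  ∃ lam : ℕ → ℝ → ℝ,
    (∀ n, StrictMono (lam n)) ∧ (∀ n, Surjective (lam n)) ∧ (∀ n, lam n 0 = 0) ∧
    ∀ T : ℝ, 0 < T →
      Tendsto (fun n => ⨆ t : Icc (0:ℝ) T, |lam n ↑t - ↑t|) atTop (nhds 0) ∧
      Tendsto (fun n => ⨆ t : Icc (0:ℝ) T, ‖x n (lam n ↑t) - x₀ ↑t‖) atTop (nhds 0)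

/-- Relative compactness in the Skorokhod `J₁` topology: every subsequence has a
further subsequence converging in `J₁`. -/
def J1RelCompact {E : Type*} [NormedAddCommGroup E] (x : ℕ → ℝ → E) : Prop :=
  ∀ φ : ℕ → ℕ, StrictMono φ → ∃ ψ : ℕ → ℕ, StrictMono ψ ∧
    ∃ x₀ : ℝ → E, J1Tendsto (fun m => x (φ (ψ m))) x₀
/-- the Euler increment `Δyⁿ_{(k+1)/n}`. -/
def eulerDy (d : ℕ) (f : Eu d → Eu d) (g : Eu d → (Eu d →L[ℝ] Eu d))
    (a : ℝ → ℝ) (z : ℝ → Eu d) (n : ℕ) (u : Eu d) (k : ℕ) : Eu d :=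
  (a (((k : ℝ) + 1) / n) - a ((k : ℝ) / n)) • f u +
    g u (z (((k : ℝ) + 1) / n) - z ((k : ℝ) / n))

/-- the Euler scheme values `xⁿ_{k/n}` with reflection at the barrier `l`
(componentwise maximum). -/
def eulerX (d : ℕ) (f : Eu d → Eu d) (g : Eu d → (Eu d →L[ℝ] Eu d))
    (a : ℝ → ℝ) (z l : ℝ → Eu d) (x0 : Eu d) (n : ℕ) : ℕ → Eu d
  | 0 => x0
  | k + 1 =>
    (WithLp.equiv 2 (Fin d → ℝ)).symm fun i =>
      max ((eulerX d f g a z l x0 n k + eulerDy d f g a z n (eulerX d f g a z l x0 n k) k) i)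
        (l (((k : ℝ) + 1) / n) i)

/-- the Euler scheme regulator values `kⁿ_{k/n}`. -/
def eulerK (d : ℕ) (f : Eu d → Eu d) (g : Eu d → (Eu d →L[ℝ] Eu d))
    (a : ℝ → ℝ) (z l : ℝ → Eu d) (x0 : Eu d) (n : ℕ) (k : ℕ) : Eu d :=
  eulerX d f g a z l x0 n k - x0 -
    ∑ j ∈ Finset.range k, eulerDy d f g a z n (eulerX d f g a z l x0 n j) j

/-- the piecewise constant Euler approximation `xⁿ_t = xⁿ_{k/n}` for
`t ∈ [k/n, (k+1)/n)`. -/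
def eulerXproc (d : ℕ) (f : Eu d → Eu d) (g : Eu d → (Eu d →L[ℝ] Eu d))
    (a : ℝ → ℝ) (z l : ℝ → Eu d) (x0 : Eu d) (n : ℕ) (t : ℝ) : Eu d :=
  eulerX d f g a z l x0 n ⌊(n : ℝ) * t⌋₊

def eulerKproc (d : ℕ) (f : Eu d → Eu d) (g : Eu d → (Eu d →L[ℝ] Eu d))
    (a : ℝ → ℝ) (z l : ℝ → Eu d) (x0 : Eu d) (n : ℕ) (t : ℝ) : Eu d :=
  eulerK d f g a z l x0 n ⌊(n : ℝ) * t⌋₊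

/-- A control on index intervals: nonnegative and superadditive. -/
structure IsControl (c : ℕ → ℕ → ℝ) : Prop where
  nonneg : ∀ {i j}, i ≤ j → 0 ≤ c i j
  superadd : ∀ {i j k}, i ≤ j → j ≤ k → c i j + c j k ≤ c i k

namespace IsControl

variable {c c' : ℕ → ℕ → ℝ}

lemma self_eq_zero (hc : IsControl c) (i : ℕ) : c i i = 0 := by
  have h1 := hc.nonneg (le_refl i)
  have h2 := hc.superadd (le_refl i) (le_refl i)
  linarith

lemma mono (hc : IsControl c) {i i' j j' : ℕ} (h1 : i' ≤ i) (h2 : i ≤ j) (h3 : j ≤ j') :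
    c i j ≤ c i' j' := by
  have a1 := hc.superadd h1 h2
  have a2 := hc.superadd (h1.trans h2) h3
  have a3 := hc.nonneg h1
  have a4 := hc.nonneg h3
  linarith

lemma sum_le (hc : IsControl c) {u : ℕ → ℕ} (hu : Monotone u) (n : ℕ) :
    ∑ i ∈ Finset.range n, c (u i) (u (i + 1)) ≤ c (u 0) (u n) := by
  induction n with
  | zero => simpa using hc.nonneg (le_refl (u 0))
  | succ n ih =>
    rw [Finset.sum_range_succ]
    have := hc.superadd (hu (Nat.zero_le n)) (hu (Nat.le_succ n))
    linarith

lemma sum_Ico_le (hc : IsControl c) {i k : ℕ} (hik : i ≤ k) :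
    ∑ j ∈ Finset.Ico i k, c j (j + 1) ≤ c i k := by
  induction k, hik using Nat.le_induction with
  | base => simpa using hc.nonneg (le_refl i)
  | succ n hn ih =>
    rw [Finset.sum_Ico_succ_top hn]
    have := hc.superadd hn (Nat.le_succ n)
    linarith

lemma add (hc : IsControl c) (hc' : IsControl c') : IsControl fun i j => c i j + c' i j where
  nonneg h := add_nonneg (hc.nonneg h) (hc'.nonneg h)
  superadd h1 h2 := by
    have := hc.superadd h1 h2
    have := hc'.superadd h1 h2
    linarith

lemma const_mul (hc : IsControl c) {r : ℝ} (hr : 0 ≤ r) : IsControl fun i j => r * c i j where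
  nonneg h := mul_nonneg hr (hc.nonneg h)
  superadd h1 h2 := by
    have := mul_le_mul_of_nonneg_left (hc.superadd h1 h2) hr
    linarith

lemma rpow (hc : IsControl c) {p : ℝ} (hp : 1 ≤ p) : IsControl fun i j => c i j ^ p where
  nonneg h := Real.rpow_nonneg (hc.nonneg h) p
  superadd h1 h2 := (Real.add_rpow_le_rpow_add (hc.nonneg h1) (hc.nonneg h2) hp).trans
    (Real.rpow_le_rpow (add_nonneg (hc.nonneg h1) (hc.nonneg h2)) (hc.superadd h1 h2)
      (by linarith))

lemma comp (hc : IsControl c) {u : ℕ → ℕ} (hu : Monotone u) :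
    IsControl fun i j => c (u i) (u j) where
  nonneg h := hc.nonneg (hu h)
  superadd h1 h2 := hc.superadd (hu h1) (hu h2)

lemma of_monotone {v : ℕ → ℝ} (hv : Monotone v) : IsControl fun i j => v j - v i where
  nonneg h := sub_nonneg.2 (hv h)
  superadd _ _ := by linarith

end IsControl

lemma rpow_mul_rpow_add_le {a₁ a₂ b₁ b₂ s r : ℝ} (ha₁ : 0 ≤ a₁) (ha₂ : 0 ≤ a₂) (hb₁ : 0 ≤ b₁)
    (hb₂ : 0 ≤ b₂) (hs : 0 ≤ s) (hr : 0 ≤ r) (hsr : s + r = 1) :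
    a₁ ^ s * b₁ ^ r + a₂ ^ s * b₂ ^ r ≤ (a₁ + a₂) ^ s * (b₁ + b₂) ^ r := by
  rcases eq_or_lt_of_le (add_nonneg ha₁ ha₂) with hA | hA
  · have h1 : a₁ = 0 := by linarith
    have h2 : a₂ = 0 := by linarith
    rcases eq_or_lt_of_le hs with hs | hs
    · have : r = 1 := by linarith
      subst hs this
      simp
    · subst h1 h2
      simp [Real.zero_rpow hs.ne']
  rcases eq_or_lt_of_le (add_nonneg hb₁ hb₂) with hB | hB
  · have h1 : b₁ = 0 := by linarith
    have h2 : b₂ = 0 := by linarith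
    rcases eq_or_lt_of_le hr with hr | hr
    · have : s = 1 := by linarith
      subst hr this
      simp
    · subst h1 h2
      simp [Real.zero_rpow hr.ne']
  have key : ∀ x y : ℝ, 0 ≤ x → 0 ≤ y → x ^ s * y ^ r ≤
      (s * (x / (a₁ + a₂)) + r * (y / (b₁ + b₂))) * ((a₁ + a₂) ^ s * (b₁ + b₂) ^ r) := by
    intro x y hx hy
    have := Real.geom_mean_le_arith_mean2_weighted hs hr (div_nonneg hx hA.le)
      (div_nonneg hy hB.le) hsr
    rw [Real.div_rpow hx hA.le, Real.div_rpow hy hB.le] at this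
    have hAs := Real.rpow_pos_of_pos hA s
    have hBr := Real.rpow_pos_of_pos hB r
    calc x ^ s * y ^ r
        = x ^ s / (a₁ + a₂) ^ s * (y ^ r / (b₁ + b₂) ^ r) *
            ((a₁ + a₂) ^ s * (b₁ + b₂) ^ r) := by field_simp
      _ ≤ _ := by gcongr
  have h1 := key a₁ b₁ ha₁ hb₁
  have h2 := key a₂ b₂ ha₂ hb₂
  have h3 : (s * (a₁ / (a₁ + a₂)) + r * (b₁ / (b₁ + b₂))) +
      (s * (a₂ / (a₁ + a₂)) + r * (b₂ / (b₁ + b₂))) = 1 := by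
    field_simp
    linear_combination (a₁ + a₂) * (b₁ + b₂) * hsr
  calc _ ≤ _ := add_le_add h1 h2
    _ = _ := by rw [← add_mul, h3, one_mul]

lemma IsControl.rpow_mul_rpow {c c' : ℕ → ℕ → ℝ} (hc : IsControl c) (hc' : IsControl c')
    {s r : ℝ} (hs : 0 ≤ s) (hr : 0 ≤ r) (hsr : s + r = 1) :
    IsControl fun i j => c i j ^ s * c' i j ^ r where
  nonneg h := mul_nonneg (Real.rpow_nonneg (hc.nonneg h) s) (Real.rpow_nonneg (hc'.nonneg h) r)
  superadd {i j k} h1 h2 := by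
    have e1 := hc.nonneg h1
    have e2 := hc.nonneg h2
    have e3 := hc'.nonneg h1
    have e4 := hc'.nonneg h2
    refine (rpow_mul_rpow_add_le e1 e2 e3 e4 hs hr hsr).trans ?_
    have := hc.superadd h1 h2
    have := hc'.superadd h1 h2
    have e5 := hc.nonneg (h1.trans h2)
    gcongr

variable {Z E : Type*} [NormedAddCommGroup Z] [NormedSpace ℝ Z] [NormedAddCommGroup E]
  [NormedSpace ℝ E]

/-- The compensated left-point sum `∑_{i ≤ j < k} (h_j - h_i) (z_{j+1} - z_j)`. -/
def compSum (h : ℕ → Z →L[ℝ] E) (z : ℕ → Z) (i k : ℕ) : E :=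
  ∑ j ∈ Finset.Ico i k, (h j - h i) (z (j + 1) - z j)

lemma sum_Ico_apply_const (A : Z →L[ℝ] E) (z : ℕ → Z) {i k : ℕ} (hik : i ≤ k) :
    ∑ j ∈ Finset.Ico i k, A (z (j + 1) - z j) = A (z k - z i) := by
  rw [← map_sum, Finset.sum_Ico_sub z hik]

lemma compSum_split (h : ℕ → Z →L[ℝ] E) (z : ℕ → Z) {i m k : ℕ} (h1 : i ≤ m) (h2 : m ≤ k) :
    compSum h z i k = compSum h z i m + compSum h z m k + (h m - h i) (z k - z m) := by
  unfold compSum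
  rw [← Finset.sum_Ico_consecutive _ h1 h2, ← sum_Ico_apply_const _ z h2, add_assoc,
    ← Finset.sum_add_distrib]
  congr 1
  refine Finset.sum_congr rfl fun j _ => ?_
  simp

lemma sum_Ico_eq_compSum (h : ℕ → Z →L[ℝ] E) (z : ℕ → Z) {i k : ℕ} (hik : i ≤ k) :
    ∑ j ∈ Finset.Ico i k, h j (z (j + 1) - z j) = h i (z k - z i) + compSum h z i k := by
  unfold compSum
  rw [← sum_Ico_apply_const _ z hik, ← Finset.sum_add_distrib]
  refine Finset.sum_congr rfl fun j _ => ?_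
  simp

lemma IsControl.exists_split {c : ℕ → ℕ → ℝ} (hc : IsControl c) {i k : ℕ} (hik : i < k) :
    ∃ m, i ≤ m ∧ m < k ∧ c i m ≤ c i k / 2 ∧ c (m + 1) k ≤ c i k / 2 := by
  classical
  have h0 := hc.nonneg hik.le
  let P : ℕ → Prop := fun m => i ≤ m ∧ c i m ≤ c i k / 2
  have hPi : P i := ⟨le_rfl, by rw [hc.self_eq_zero]; linarith⟩
  have hm : P (Nat.findGreatest P (k - 1)) :=
    Nat.findGreatest_spec (P := P) (by omega : i ≤ k - 1) hPi
  have hle : Nat.findGreatest P (k - 1) ≤ k - 1 := Nat.findGreatest_le _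
  have hgr : ∀ n, Nat.findGreatest P (k - 1) < n → n ≤ k - 1 → ¬ P n := fun n h1 h2 =>
    Nat.findGreatest_is_greatest h1 h2
  generalize Nat.findGreatest P (k - 1) = m at hm hle hgr
  refine ⟨m, hm.1, by omega, hm.2, ?_⟩
  rcases eq_or_lt_of_le (by omega : m + 1 ≤ k) with h | h
  · rw [h, hc.self_eq_zero]; linarith
  · have h1 := hgr (m + 1) (by omega) (by omega)
    have h2 : c i k / 2 < c i (m + 1) := by
      by_contra hcon
      exact h1 ⟨by omega, not_lt.1 hcon⟩
    have := hc.superadd (by omega : i ≤ m + 1) h.le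
    linarith

/-- Discrete sewing estimate for compensated sums. -/
theorem norm_compSum_le {c : ℕ → ℕ → ℝ} (hc : IsControl c) {θ D : ℝ} (hθ : 1 < θ) (hD : 0 ≤ D)
    (h : ℕ → Z →L[ℝ] E) (z : ℕ → Z) (N : ℕ) (i₀ : ℕ)
    (hb : ∀ i j k, i₀ ≤ i → i ≤ j → j < k → k ≤ N →
      ‖h j - h i‖ * ‖z k - z j‖ ≤ D * c i k ^ θ)
    (i k : ℕ) (hi : i₀ ≤ i) (hik : i ≤ k) (hk : k ≤ N) :
    ‖compSum h z i k‖ ≤ 2 / (1 - 2 ^ (1 - θ)) * D * c i k ^ θ := by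
  have hpow : (2 : ℝ) ^ (1 - θ) < 1 := Real.rpow_lt_one_of_one_lt_of_neg (by norm_num) (by linarith)
  have hpos : 0 < 1 - (2 : ℝ) ^ (1 - θ) := by linarith
  set C : ℝ := 2 / (1 - 2 ^ (1 - θ)) with hC
  have hC0 : 0 ≤ C := by positivity
  have hCeq : 2 + C * 2 ^ (1 - θ) = C := by
    rw [hC]; field_simp; ring
  have hb' : ∀ i j k, i₀ ≤ i → i ≤ j → j ≤ k → k ≤ N →
      ‖(h j - h i) (z k - z j)‖ ≤ D * c i k ^ θ := by
    intro i j k h1 h2 h3 h4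
    rcases eq_or_lt_of_le h3 with rfl | h3
    · simp only [sub_self, map_zero, norm_zero]
      exact mul_nonneg hD (Real.rpow_nonneg (hc.nonneg h2) _)
    · exact (ContinuousLinearMap.le_opNorm _ _).trans (hb i j k h1 h2 h3 h4)
  induction hn : k - i using Nat.strong_induction_on generalizing i k with
  | _ n ih =>
    have hcik := hc.nonneg hik
    rcases eq_or_lt_of_le hik with rfl | hlt
    · simp only [compSum, Finset.Ico_self, Finset.sum_empty, norm_zero]
      exact mul_nonneg (mul_nonneg hC0 hD) (Real.rpow_nonneg hcik _)
    obtain ⟨m, h1, h2, h3, h4⟩ := hc.exists_split hlt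
    have e1 := ih (m - i) (by omega) i m hi h1 (by omega) rfl
    have e2 := ih (k - (m + 1)) (by omega) (m + 1) k (by omega) (by omega) hk rfl
    have e3 := hb' i m (m + 1) hi h1 (by omega) (by omega)
    have e4 := hb' i (m + 1) k hi (by omega) (by omega) hk
    have hs : compSum h z m (m + 1) = 0 := by simp [compSum]
    have hθ0 : 0 ≤ θ := by linarith
    have f1 : c i m ^ θ ≤ c i k ^ θ * 2 ^ (-θ) := by
      rw [Real.rpow_neg (by norm_num), ← div_eq_mul_inv, ← Real.div_rpow hcik (by norm_num)]
      exact Real.rpow_le_rpow (hc.nonneg h1) h3 hθ0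
    have f2 : c (m + 1) k ^ θ ≤ c i k ^ θ * 2 ^ (-θ) := by
      rw [Real.rpow_neg (by norm_num), ← div_eq_mul_inv, ← Real.div_rpow hcik (by norm_num)]
      exact Real.rpow_le_rpow (hc.nonneg (by omega)) h4 hθ0
    have f3 : c i (m + 1) ^ θ ≤ c i k ^ θ :=
      Real.rpow_le_rpow (hc.nonneg (by omega)) (hc.mono le_rfl (by omega) (by omega)) hθ0
    have f4 : (2 : ℝ) ^ (1 - θ) = 2 * 2 ^ (-θ) := by
      rw [sub_eq_add_neg, Real.rpow_add (by norm_num), Real.rpow_one]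
    rw [compSum_split h z (by omega : i ≤ m + 1) (by omega : m + 1 ≤ k),
      compSum_split h z h1 (by omega : m ≤ m + 1), hs, add_zero]
    calc _ ≤ ‖compSum h z i m‖ + ‖(h m - h i) (z (m + 1) - z m)‖ + ‖compSum h z (m + 1) k‖
          + ‖(h (m + 1) - h i) (z k - z (m + 1))‖ :=
          (norm_add_le _ _).trans (add_le_add ((norm_add_le _ _).trans
            (add_le_add (norm_add_le _ _) le_rfl)) le_rfl)
      _ ≤ C * D * (c i k ^ θ * 2 ^ (-θ)) + D * c i k ^ θ + C * D * (c i k ^ θ * 2 ^ (-θ))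
          + D * c i k ^ θ := by
          refine add_le_add (add_le_add (add_le_add (e1.trans ?_) (e3.trans ?_))
            (e2.trans ?_)) e4 <;> gcongr
      _ = (2 + C * 2 ^ (1 - θ)) * (D * c i k ^ θ) := by rw [f4]; ring
      _ = C * D * c i k ^ θ := by rw [hCeq]; ring

/-- Discrete Young estimate. -/
theorem norm_compSum_le_young {ω w : ℕ → ℕ → ℝ} (hω : IsControl ω) (hw : IsControl w)
    {β γ D : ℝ} (hβ : 0 < β) (hγ : 0 < γ) (hβγ : 1 < β + γ) (hD : 0 ≤ D)
    (h : ℕ → Z →L[ℝ] E) (z : ℕ → Z) (N i₀ : ℕ)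
    (hh : ∀ i j, i₀ ≤ i → i ≤ j → j < N → ‖h j - h i‖ ≤ D * ω i j ^ β)
    (hz : ∀ j k, i₀ ≤ j → j ≤ k → k ≤ N → ‖z k - z j‖ ≤ w j k ^ γ)
    (i k : ℕ) (hi : i₀ ≤ i) (hik : i ≤ k) (hk : k ≤ N) :
    ‖compSum h z i k‖ ≤ 2 / (1 - 2 ^ (1 - (β + γ))) * D * (ω i k ^ β * w i k ^ γ) := by
  have hs : 0 < β + γ := by linarith
  have hc := hω.rpow_mul_rpow hw (s := β / (β + γ)) (r := γ / (β + γ)) (by positivity)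
    (by positivity) (by field_simp)
  have hp : ∀ i k, i ≤ k → (ω i k ^ (β / (β + γ)) * w i k ^ (γ / (β + γ))) ^ (β + γ) =
      ω i k ^ β * w i k ^ γ := by
    intro i k hik
    have h1 := hω.nonneg hik
    have h2 := hw.nonneg hik
    rw [Real.mul_rpow (by positivity) (by positivity), ← Real.rpow_mul h1, ← Real.rpow_mul h2]
    congr 2 <;> field_simp
  have := norm_compSum_le hc hβγ hD h z N i₀ (fun i j k h1 h2 h3 h4 => by
    rw [hp i k (by omega)]
    have e1 := hh i j h1 h2 (by omega)
    have e2 := hz j k (by omega) (by omega) h4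
    have e3 := hω.nonneg h2
    have e4 := hw.nonneg h3.le
    have e5 := hω.nonneg (h2.trans h3.le)
    calc _ ≤ (D * ω i j ^ β) * w j k ^ γ := by gcongr
      _ ≤ (D * ω i k ^ β) * w i k ^ γ := by
        gcongr
        · exact hω.mono le_rfl h2 h3.le
        · exact hw.mono h2 h3.le le_rfl
      _ = _ := by ring) i k hi hik hk
  rwa [hp i k hik] at this

lemma Eu.abs_apply_le_norm {d : ℕ} (u : Eu d) (i : Fin d) : |u i| ≤ ‖u‖ := by
  simpa using PiLp.norm_apply_le u i

lemma Eu.norm_le_norm_of_abs_le {d : ℕ} {u v : Eu d} (h : ∀ i, |u i| ≤ |v i|) : ‖u‖ ≤ ‖v‖ := by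
  rw [EuclideanSpace.norm_eq, EuclideanSpace.norm_eq]
  refine Real.sqrt_le_sqrt (Finset.sum_le_sum fun i _ => ?_)
  simpa using sq_le_sq.2 (h i)

lemma Eu.norm_le_sum_abs {d : ℕ} (u : Eu d) : ‖u‖ ≤ ∑ i, |u i| := by
  rw [EuclideanSpace.norm_eq]
  refine Real.sqrt_le_iff.2 ⟨Finset.sum_nonneg fun _ _ => abs_nonneg _, ?_⟩
  exact Finset.sum_sq_le_sq_sum_of_nonneg fun _ _ => abs_nonneg _

/-- Reflected Euler recursion along a sequence of driver and barrier values; `y` is the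
unconstrained part and `x - y` the regulator. -/
structure IsEuler {d : ℕ} (f : Eu d → Eu d) (g : Eu d → (Eu d →L[ℝ] Eu d)) (a : ℕ → ℝ)
    (z l x y : ℕ → Eu d) : Prop where
  y_zero : y 0 = x 0
  y_succ : ∀ j, y (j + 1) = y j + ((a (j + 1) - a j) • f (x j) + g (x j) (z (j + 1) - z j))
  x_succ : ∀ j i, x (j + 1) i = max (x j i + (y (j + 1) i - y j i)) (l (j + 1) i)
  l_zero : ∀ i, l 0 i ≤ x 0 i

/-- Total regulator: the sum of the coordinates of `x - y`. -/
def totalReg {d : ℕ} (x y : ℕ → Eu d) (j : ℕ) : ℝ := ∑ i, (x j i - y j i)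

namespace IsEuler

variable {d : ℕ} {f : Eu d → Eu d} {g : Eu d → (Eu d →L[ℝ] Eu d)} {a : ℕ → ℝ}
  {z l x y : ℕ → Eu d}

lemma reg_succ (h : IsEuler f g a z l x y) (j : ℕ) (i : Fin d) :
    x (j + 1) i - y (j + 1) i = max (x j i - y j i) (l (j + 1) i - y (j + 1) i) := by
  rw [h.x_succ, ← max_sub_sub_right]
  congr 1
  ring

lemma reg_mono (h : IsEuler f g a z l x y) (i : Fin d) : Monotone fun j => x j i - y j i :=
  monotone_nat_of_le_succ fun j => by
    rw [h.reg_succ]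
    exact le_max_left _ _

lemma l_le (h : IsEuler f g a z l x y) (j : ℕ) (i : Fin d) : l j i ≤ x j i := by
  cases j with
  | zero => exact h.l_zero i
  | succ j => rw [h.x_succ]; exact le_max_right _ _

lemma reg_le_of (h : IsEuler f g a z l x y) {b e : ℕ} (hbe : b ≤ e) {i : Fin d} {D : ℝ}
    (hb : x b i - y b i ≤ D) (hD : ∀ j, b ≤ j → j ≤ e → l j i - y j i ≤ D) :
    x e i - y e i ≤ D := by
  induction e, hbe using Nat.le_induction with
  | base => exact hb
  | succ n hn ih =>
    rw [h.reg_succ]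
    exact max_le (ih fun j h1 h2 => hD j h1 (by omega)) (hD _ (by omega) le_rfl)

lemma reg_sub_le (h : IsEuler f g a z l x y) {b e : ℕ} (hbe : b ≤ e) {D D' : ℝ}
    (hl : ∀ j, b ≤ j → j ≤ e → ‖l j - l b‖ ≤ D) (hy : ∀ j, b ≤ j → j ≤ e → ‖y j - y b‖ ≤ D')
    (i : Fin d) : (x e i - y e i) - (x b i - y b i) ≤ D + D' := by
  have hD : 0 ≤ D := (norm_nonneg _).trans (hl b le_rfl hbe)
  have hD' : 0 ≤ D' := (norm_nonneg _).trans (hy b le_rfl hbe)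
  have := h.reg_le_of hbe (i := i) (D := D + D' + (x b i - y b i)) (by linarith) fun j h1 h2 => by
    have e1 := (Eu.abs_apply_le_norm (l j - l b) i).trans (hl j h1 h2)
    have e2 := (Eu.abs_apply_le_norm (y j - y b) i).trans (hy j h1 h2)
    have e3 := h.l_le b i
    simp only [PiLp.sub_apply] at e1 e2
    rw [abs_le] at e1 e2
    linarith
  linarith

lemma totalReg_mono (h : IsEuler f g a z l x y) : Monotone (totalReg x y) := fun _ _ hij =>
  Finset.sum_le_sum fun i _ => h.reg_mono i hij

lemma totalReg_sub_le (h : IsEuler f g a z l x y) {b e : ℕ} (hbe : b ≤ e) {D D' : ℝ}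
    (hl : ∀ j, b ≤ j → j ≤ e → ‖l j - l b‖ ≤ D) (hy : ∀ j, b ≤ j → j ≤ e → ‖y j - y b‖ ≤ D') :
    totalReg x y e - totalReg x y b ≤ d * (D + D') := by
  unfold totalReg
  rw [← Finset.sum_sub_distrib]
  refine (Finset.sum_le_sum fun i _ => h.reg_sub_le hbe hl hy i).trans ?_
  simp [mul_add]

lemma norm_reg_sub_le (h : IsEuler f g a z l x y) {i j : ℕ} (hij : i ≤ j) :
    ‖(x j - y j) - (x i - y i)‖ ≤ totalReg x y j - totalReg x y i := by
  refine (Eu.norm_le_sum_abs _).trans (le_of_eq ?_)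
  unfold totalReg
  rw [← Finset.sum_sub_distrib]
  refine Finset.sum_congr rfl fun c _ => ?_
  simpa using h.reg_mono c hij

lemma norm_x_sub_le (h : IsEuler f g a z l x y) {i j : ℕ} (hij : i ≤ j) :
    ‖x j - x i‖ ≤ ‖y j - y i‖ + (totalReg x y j - totalReg x y i) := by
  have := h.norm_reg_sub_le hij
  calc ‖x j - x i‖ = ‖(y j - y i) + ((x j - y j) - (x i - y i))‖ := by congr 1; abel
    _ ≤ _ := (norm_add_le _ _).trans (by linarith)

lemma y_sub (h : IsEuler f g a z l x y) {i k : ℕ} (hik : i ≤ k) :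
    y k - y i = (∑ j ∈ Finset.Ico i k, (a (j + 1) - a j) • f (x j)) +
      ∑ j ∈ Finset.Ico i k, g (x j) (z (j + 1) - z j) := by
  rw [← Finset.sum_Ico_sub y hik, ← Finset.sum_add_distrib]
  refine Finset.sum_congr rfl fun j _ => ?_
  rw [h.y_succ]; abel

lemma norm_x_succ_le (h : IsEuler f g a z l x y) (j : ℕ) :
    ‖x (j + 1)‖ ≤ ‖x j‖ + ‖y (j + 1) - y j‖ + 2 * ‖l (j + 1)‖ := by
  have : ‖x (j + 1) - l (j + 1)‖ ≤ ‖x j + (y (j + 1) - y j) - l (j + 1)‖ := by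
    refine Eu.norm_le_norm_of_abs_le fun i => ?_
    simp only [PiLp.sub_apply, PiLp.add_apply]
    rw [h.x_succ, ← max_sub_sub_right, sub_self]
    rcases le_total (x j i + (y (j + 1) i - y j i) - l (j + 1) i) 0 with h0 | h0
    · rw [max_eq_right h0, abs_zero]; exact abs_nonneg _
    · rw [max_eq_left h0]
  have h1 := norm_sub_norm_le (x (j + 1)) (l (j + 1))
  have h2 := norm_sub_le (x j + (y (j + 1) - y j)) (l (j + 1))
  have h3 := norm_add_le (x j) (y (j + 1) - y j)
  linarith

end IsEuler

lemma rpow_le_one_add {t α : ℝ} (ht : 0 ≤ t) (h0 : 0 ≤ α) (h1 : α ≤ 1) : t ^ α ≤ 1 + t := by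
  rcases le_total t 1 with h | h
  · have := Real.rpow_le_one ht h h0; linarith
  · have := Real.rpow_le_rpow_of_exponent_le h h1
    rw [Real.rpow_one] at this; linarith

lemma le_rpow_of_le_one {t p : ℝ} (ht : 0 ≤ t) (ht1 : t ≤ 1) (hp : 1 ≤ p) : t ≤ t ^ (1 / p) := by
  have h : 1 / p ≤ 1 := by rw [div_le_one (by linarith)]; exact hp
  have := Real.rpow_le_rpow_of_exponent_ge_of_imp ht ht1 h (fun _ h0 => by simp at h0)
  simpa using this

/-- A common bound for `ω = (2 A)^p w + (2 K)^p`. -/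
lemma add_le_ctrl_rpow {p A w K : ℝ} (hp : 1 ≤ p) (hA : 0 ≤ A) (hw : 0 ≤ w) (hK : 0 ≤ K) :
    A * w ^ (1 / p) + K ≤ ((2 * A) ^ p * w + (2 * K) ^ p) ^ (1 / p) := by
  have hp0 : 0 < p := by linarith
  have e1 : 2 * (A * w ^ (1 / p)) ≤ ((2 * A) ^ p * w + (2 * K) ^ p) ^ (1 / p) := by
    calc 2 * (A * w ^ (1 / p)) = ((2 * A) ^ p * w) ^ (1 / p) := by
          rw [Real.mul_rpow (by positivity) hw, ← Real.rpow_mul (by positivity),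
            mul_one_div_cancel hp0.ne', Real.rpow_one]; ring
      _ ≤ _ := Real.rpow_le_rpow (by positivity)
        (le_add_of_nonneg_right (by positivity)) (by positivity)
  have e2 : 2 * K ≤ ((2 * A) ^ p * w + (2 * K) ^ p) ^ (1 / p) := by
    calc 2 * K = ((2 * K) ^ p) ^ (1 / p) := by
          rw [← Real.rpow_mul (by positivity), mul_one_div_cancel hp0.ne', Real.rpow_one]
      _ ≤ _ := Real.rpow_le_rpow (by positivity)
        (le_add_of_nonneg_left (by positivity)) (by positivity)
  linarith

lemma ctrl_rpow_le_add {p A w K : ℝ} (hp : 1 ≤ p) (hA : 0 ≤ A) (hw : 0 ≤ w) (hK : 0 ≤ K) :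
    ((2 * A) ^ p * w + (2 * K) ^ p) ^ (1 / p) ≤ 2 * A * w ^ (1 / p) + 2 * K := by
  have hp0 : 0 < p := by linarith
  refine (Real.rpow_add_le_add_rpow (by positivity) (by positivity) (by positivity)
    (by rw [div_le_one hp0]; exact hp)).trans (le_of_eq ?_)
  rw [Real.mul_rpow (by positivity) hw, ← Real.rpow_mul (by positivity),
    ← Real.rpow_mul (by positivity), mul_one_div_cancel hp0.ne', Real.rpow_one, Real.rpow_one]

lemma norm_coeff_le {d : ℕ} {α Cα : ℝ} (hα : 0 ≤ α) (hα2 : α ≤ 1) (hC : 0 ≤ Cα)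
    {g : Eu d → (Eu d →L[ℝ] Eu d)} (hg : ∀ u v : Eu d, ‖g u - g v‖ ≤ Cα * ‖u - v‖ ^ α)
    (u : Eu d) : ‖g u‖ ≤ (‖g 0‖ + Cα) * (1 + ‖u‖) := by
  have h1 := hg u 0
  have h2 := rpow_le_one_add (norm_nonneg (u - 0)) hα hα2
  have h3 := norm_le_norm_add_norm_sub' (g u) (g 0)
  rw [sub_zero] at h1 h2
  have h4 : Cα * ‖u‖ ^ α ≤ Cα * (1 + ‖u‖) := by gcongr
  have h5 : 0 ≤ ‖g 0‖ * ‖u‖ := by positivity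
  linarith

section Block

variable {d : ℕ} {p α L Cα : ℝ} {f : Eu d → Eu d} {g : Eu d → (Eu d →L[ℝ] Eu d)}

/-- The growth constant in the local a priori estimate for the Euler scheme. -/
def blockConst (d : ℕ) (p α L Cα : ℝ) (g : Eu d → (Eu d →L[ℝ] Eu d)) : ℝ :=
  (L + (‖g 0‖ + Cα) + 2 / (1 - 2 ^ (1 - (α / p + 1 / p))) * Cα) * (2 * d + 2)

lemma youngConst_nonneg (hp : 1 ≤ p) (hα1 : p - 1 < α) :
    0 ≤ (2 : ℝ) / (1 - 2 ^ (1 - (α / p + 1 / p))) := by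
  have h : 1 < α / p + 1 / p := by
    rw [← add_div, lt_div_iff₀ (by linarith)]; linarith
  have : (2 : ℝ) ^ (1 - (α / p + 1 / p)) < 1 :=
    Real.rpow_lt_one_of_one_lt_of_neg (by norm_num) (by linarith)
  exact div_nonneg (by norm_num) (by linarith)

lemma blockConst_pos (hp : 1 ≤ p) (hα1 : p - 1 < α) (hL : 0 < L) (hCα : 0 < Cα) :
    0 < blockConst d p α L Cα g := by
  have := youngConst_nonneg hp hα1
  unfold blockConst
  positivity

theorem IsEuler.norm_y_sub_le_block (hp : 1 ≤ p) (hα1 : p - 1 < α) (hα2 : α ≤ 1)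
    (hL : 0 < L) (hCα : 0 < Cα) (hflin : ∀ u : Eu d, ‖f u‖ ≤ L * (1 + ‖u‖))
    (hg : ∀ u v : Eu d, ‖g u - g v‖ ≤ Cα * ‖u - v‖ ^ α)
    {a : ℕ → ℝ} {z l x y : ℕ → Eu d} (h : IsEuler f g a z l x y)
    {w : ℕ → ℕ → ℝ} (hw : IsControl w) (b e : ℕ) (hbe : b ≤ e)
    (hz : ∀ i j, i ≤ j → j ≤ e → ‖z j - z i‖ ≤ w i j ^ (1 / p))
    (ha : ∀ i j, i ≤ j → j ≤ e → |a j - a i| ≤ w i j)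
    (hw1 : w b e ≤ 1) (hwb : w b e ^ (1 / p) ≤ 1 / (2 * blockConst d p α L Cα g))
    (hl : ∀ j, b ≤ j → j ≤ e → ‖l j - l b‖ ≤ 1)
    (i k : ℕ) (hbi : b ≤ i) (hik : i ≤ k) (hke : k ≤ e) :
    ‖y k - y i‖ ≤ 2 * blockConst d p α L Cα g * (1 + ‖x b‖) * w i k ^ (1 / p) := by
  have hp0 : 0 < p := by linarith
  have hα0 : 0 < α := by linarith
  have hC1 : 0 < blockConst d p α L Cα g := blockConst_pos hp hα1 hL hCα
  set C1 := blockConst d p α L Cα g with hC1def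
  set A := 2 * C1 * (1 + ‖x b‖) with hA
  have hA0 : 0 ≤ A := by positivity
  induction e, hbe using Nat.le_induction generalizing i k with
  | base =>
    obtain rfl : i = b := by omega
    obtain rfl : k = i := by omega
    simp only [sub_self, norm_zero]
    exact mul_nonneg hA0 (Real.rpow_nonneg (hw.nonneg le_rfl) _)
  | succ e hbe ih =>
    have hwe : w b e ≤ w b (e + 1) := hw.mono le_rfl hbe (by omega)
    have hwbe := hw.nonneg hbe
    have ih' := fun i k h1 h2 h3 => ih (fun i j h1 h2 => hz i j h1 (by omega)) (fun i j h1 h2 => ha i j h1 (by omega))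
      (hwe.trans hw1) (fun j h1 h2 => hl j h1 (by omega)) i k h1 h2 h3
      ((Real.rpow_le_rpow hwbe hwe (by positivity)).trans hwb)
    rcases Nat.lt_or_ge e k with hk | hk
    swap
    · exact ih' i k hbi hik hk
    obtain rfl : k = e + 1 := by omega
    rcases eq_or_lt_of_le hik with rfl | hlt
    · simp only [sub_self, norm_zero]
      exact mul_nonneg hA0 (Real.rpow_nonneg (hw.nonneg le_rfl) _)
    have hie : i ≤ e := by omega
    set ϑ := w b (e + 1) ^ (1 / p) with hϑ
    have hϑ0 : 0 ≤ ϑ := Real.rpow_nonneg (hw.nonneg (by omega)) _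
    have hwϑ : ∀ i j, b ≤ i → i ≤ j → j ≤ e + 1 → w i j ^ (1 / p) ≤ ϑ := fun i j h1 h2 h3 =>
      Real.rpow_le_rpow (hw.nonneg h2) (hw.mono h1 h2 h3) (by positivity)
    have hyb : ∀ i j, b ≤ i → i ≤ j → j ≤ e → ‖y j - y i‖ ≤ A * ϑ := fun i j h1 h2 h3 =>
      (ih' i j h1 h2 h3).trans (by gcongr; exact hwϑ i j h1 h2 (by omega))
    have hAϑ : 0 ≤ A * ϑ := mul_nonneg hA0 hϑ0
    have hK : ∀ i j, b ≤ i → i ≤ j → j ≤ e →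
        totalReg x y j - totalReg x y i ≤ d * (1 + A * ϑ) := fun i j h1 h2 h3 => by
      have e1 := h.totalReg_sub_le (b := b) (e := j) (by omega)
        (fun j' h4 h5 => hl j' h4 (by omega)) (fun j' h4 h5 => hyb b j' le_rfl h4 (by omega))
      have e2 := h.totalReg_mono h1
      linarith
    have hX : ∀ j, b ≤ j → j ≤ e → 1 + ‖x j‖ ≤ (d + 1) * (1 + ‖x b‖ + A * ϑ) := by
      intro j h1 h2
      have e1 := h.norm_x_sub_le h1
      have e2 := hyb b j le_rfl h1 h2
      have e3 := hK b j le_rfl h1 h2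
      have e4 := norm_le_norm_add_norm_sub' (x j) (x b)
      have e5 : (0 : ℝ) ≤ d * ‖x b‖ := by positivity
      linarith
    have hW0 := hw.nonneg hik
    have hwle1 : w i (e + 1) ≤ 1 := (hw.mono hbi hik le_rfl).trans hw1
    have hfin : ‖∑ j ∈ Finset.Ico i (e + 1), (a (j + 1) - a j) • f (x j)‖ ≤
        L * ((d + 1) * (1 + ‖x b‖ + A * ϑ)) * w i (e + 1) ^ (1 / p) := by
      calc _ ≤ ∑ j ∈ Finset.Ico i (e + 1), w j (j + 1) * (L * ((d + 1) * (1 + ‖x b‖ + A * ϑ))) := by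
            refine norm_sum_le_of_le _ fun j hj => ?_
            rw [Finset.mem_Ico] at hj
            rw [norm_smul, Real.norm_eq_abs]
            have e1 := ha j (j + 1) (by omega) (by omega)
            have e2 := (hflin (x j)).trans
              (mul_le_mul_of_nonneg_left (hX j (by omega) (by omega)) hL.le)
            exact mul_le_mul e1 e2 (norm_nonneg _) (hw.nonneg (by omega))
        _ ≤ w i (e + 1) * (L * ((d + 1) * (1 + ‖x b‖ + A * ϑ))) := by
            rw [← Finset.sum_mul]
            gcongr
            exact hw.sum_Ico_le hik
        _ ≤ w i (e + 1) ^ (1 / p) * (L * ((d + 1) * (1 + ‖x b‖ + A * ϑ))) := by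
            gcongr
            exact le_rpow_of_le_one hW0 hwle1 hp
        _ = _ := by ring
    have hg1 : ‖g (x i) (z (e + 1) - z i)‖ ≤
        (‖g 0‖ + Cα) * ((d + 1) * (1 + ‖x b‖ + A * ϑ)) * w i (e + 1) ^ (1 / p) := by
      refine (ContinuousLinearMap.le_opNorm _ _).trans ?_
      have e1 := norm_coeff_le hα0.le hα2 hCα.le hg (x i)
      have e2 := hz i (e + 1) hik le_rfl
      have e3 := hX i hbi hie
      have e4 : ‖g (x i)‖ ≤ (‖g 0‖ + Cα) * ((d + 1) * (1 + ‖x b‖ + A * ϑ)) :=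
        e1.trans (by gcongr)
      exact mul_le_mul e4 e2 (norm_nonneg _) (by positivity)
    let ω : ℕ → ℕ → ℝ := fun i j => (2 * A) ^ p * w (min i e) (min j e) +
      (2 * (totalReg x y (min j e) - totalReg x y (min i e))) ^ p
    have hmin : Monotone fun j => min j e := fun i j hij => min_le_min hij le_rfl
    have hω : IsControl ω :=
      ((hw.comp hmin).const_mul (by positivity)).add
        ((((IsControl.of_monotone h.totalReg_mono).comp hmin).const_mul (by norm_num)).rpow hp)
    have hωle : ω i (e + 1) ^ (α / p) ≤ (2 * d + 2) * (1 + ‖x b‖ + A * ϑ) := by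
      have e0 := hω.nonneg hik
      have e1 : ω i (e + 1) ^ (1 / p) ≤ 2 * A * ϑ + 2 * (d * (1 + A * ϑ)) := by
        have hm1 : min (e + 1) e = e := by omega
        have hm2 : min i e = i := by omega
        have e2 := ctrl_rpow_le_add hp hA0 (hw.nonneg hie) (sub_nonneg.2 (h.totalReg_mono hie))
        have e3 := hK i e hbi hie le_rfl
        have e4 : 2 * A * w i e ^ (1 / p) ≤ 2 * A * ϑ := by
          gcongr
          exact hwϑ i e hbi hie (by omega)
        simp only [ω, hm1, hm2]
        linarith
      have e5 := rpow_le_one_add (Real.rpow_nonneg e0 (1 / p)) hα0.le hα2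
      rw [← Real.rpow_mul e0, one_div_mul_eq_div] at e5
      have e6 : 0 ≤ (2 * d + 1) * ‖x b‖ := by positivity
      have e7 : 0 ≤ ‖x b‖ := norm_nonneg _
      linarith
    have hβγ : 1 < α / p + 1 / p := by
      rw [← add_div, lt_div_iff₀ hp0]; linarith
    have hg2 : ‖compSum (fun j => g (x j)) z i (e + 1)‖ ≤
        2 / (1 - 2 ^ (1 - (α / p + 1 / p))) * Cα *
          (ω i (e + 1) ^ (α / p) * w i (e + 1) ^ (1 / p)) := by
      refine norm_compSum_le_young hω hw (by positivity) (by positivity) hβγ hCα.le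
        (fun j => g (x j)) z (e + 1) b ?_ (fun j k _ h2 h3 => hz j k h2 h3) i (e + 1) hbi hik le_rfl
      intro i j h1 h2 h3
      refine (hg (x j) (x i)).trans ?_
      have hm1 : min j e = j := by omega
      have hm2 : min i e = i := by omega
      have e1 : ‖x j - x i‖ ≤ ω i j ^ (1 / p) := by
        simp only [ω, hm1, hm2]
        refine le_trans ?_ (add_le_ctrl_rpow hp hA0 (hw.nonneg h2)
          (sub_nonneg.2 (h.totalReg_mono h2)))
        exact (h.norm_x_sub_le h2).trans (add_le_add (ih' i j h1 h2 (by omega)) le_rfl)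
      have e2 := Real.rpow_le_rpow (norm_nonneg _) e1 hα0.le
      rw [← Real.rpow_mul (hω.nonneg h2), one_div_mul_eq_div] at e2
      gcongr
    have hY := youngConst_nonneg hp hα1
    set Y : ℝ := 2 / (1 - 2 ^ (1 - (α / p + 1 / p)))
    rw [h.y_sub hik, sum_Ico_eq_compSum (fun j => g (x j)) z hik]
    set B := 1 + ‖x b‖ + A * ϑ with hB
    have hB0 : 0 ≤ B := by positivity
    set W := w i (e + 1) ^ (1 / p) with hW
    have hWn : 0 ≤ W := Real.rpow_nonneg hW0 _
    have hfinal : C1 * B ≤ A := by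
      have : C1 * (A * ϑ) ≤ C1 * (1 + ‖x b‖) := by
        have e1 : 2 * C1 * ϑ ≤ 1 := by
          rw [le_div_iff₀ (by positivity)] at hwb; linarith
        calc C1 * (A * ϑ) = (C1 * (1 + ‖x b‖)) * (2 * C1 * ϑ) := by rw [hA]; ring
          _ ≤ (C1 * (1 + ‖x b‖)) * 1 := by gcongr
          _ = _ := mul_one _
      rw [hB, hA]; linarith
    calc _ ≤ L * ((d + 1) * B) * W + ((‖g 0‖ + Cα) * ((d + 1) * B) * W +
            Y * Cα * (((2 * d + 2) * B) * W)) := by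
          refine (norm_add_le _ _).trans (add_le_add hfin ((norm_add_le _ _).trans
            (add_le_add hg1 (hg2.trans ?_))))
          gcongr
      _ ≤ C1 * B * W := by
          rw [hC1def, blockConst]
          have : 0 ≤ (L + (‖g 0‖ + Cα)) * ((d + 1) * B) * W := by positivity
          linarith
      _ ≤ A * W := by gcongr

end Block

/-- A control function on pairs of nonnegative times. -/
structure IsTimeControl (w : ℝ → ℝ → ℝ) : Prop where
  nonneg : ∀ {s t : ℝ}, 0 ≤ s → s ≤ t → 0 ≤ w s t
  superadd : ∀ {s t r : ℝ}, 0 ≤ s → s ≤ t → t ≤ r → w s t + w t r ≤ w s r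

lemma IsTimeControl.mono {w : ℝ → ℝ → ℝ} (hw : IsTimeControl w) {s' s t t' : ℝ} (h0 : 0 ≤ s')
    (h1 : s' ≤ s) (h2 : s ≤ t) (h3 : t ≤ t') : w s t ≤ w s' t' := by
  have e1 := hw.superadd h0 h1 h2
  have e2 := hw.superadd h0 (h1.trans h2) h3
  have e3 := hw.nonneg h0 h1
  have e4 := hw.nonneg (h0.trans (h1.trans h2)) h3
  linarith

lemma IsTimeControl.add {w w' : ℝ → ℝ → ℝ} (hw : IsTimeControl w) (hw' : IsTimeControl w') :
    IsTimeControl fun s t => w s t + w' s t where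
  nonneg h0 h1 := add_nonneg (hw.nonneg h0 h1) (hw'.nonneg h0 h1)
  superadd h0 h1 h2 := by
    have := hw.superadd h0 h1 h2
    have := hw'.superadd h0 h1 h2
    linarith

lemma IsTimeControl.grid {w : ℝ → ℝ → ℝ} (hw : IsTimeControl w) (n : ℕ) :
    IsControl fun i j => w ((i : ℝ) / n) ((j : ℝ) / n) where
  nonneg h := hw.nonneg (by positivity) (by gcongr)
  superadd h1 h2 := hw.superadd (by positivity) (by gcongr) (by gcongr)

/-- Every finite partition extends to a monotone sequence. -/
lemma exists_monotone_seq {n : ℕ} {t : Fin (n + 1) → ℝ} (ht : Monotone t) :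
    ∃ u : ℕ → ℝ, Monotone u ∧ u 0 = t 0 ∧ u n = t (Fin.last n) ∧
      ∀ i : Fin n, u i = t i.castSucc ∧ u (i + 1) = t i.succ := by
  refine ⟨fun i => t ⟨min i n, by omega⟩, fun i j hij => ht ?_, ?_, ?_, fun i => ⟨?_, ?_⟩⟩
  · simp only [Fin.mk_le_mk]; omega
  · exact congrArg t (Fin.ext (by simp))
  · exact congrArg t (Fin.ext (by simp))
  · exact congrArg t (Fin.ext (by simp))
  · exact congrArg t (Fin.ext (by simp))

section Variation

variable {E : Type*} [NormedAddCommGroup E] {p : ℝ} {x : ℝ → E}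

lemma mem_varSums_iff {a b v : ℝ} : v ∈ varSums p x a b ↔ ∃ (n : ℕ) (u : ℕ → ℝ), Monotone u ∧
    u 0 = a ∧ u n = b ∧ v = ∑ i ∈ Finset.range n, ‖x (u (i + 1)) - x (u i)‖ ^ p := by
  constructor
  · rintro ⟨n, t, ht, h0, h1, rfl⟩
    obtain ⟨u, hu, hu0, hun, hi⟩ := exists_monotone_seq ht
    refine ⟨n, u, hu, hu0.trans h0, hun.trans h1, ?_⟩
    rw [Finset.sum_range]
    exact Finset.sum_congr rfl fun i _ => by rw [(hi i).1, (hi i).2]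
  · rintro ⟨n, u, hu, h0, h1, rfl⟩
    refine ⟨n, fun i => u i, fun i j hij => hu hij, h0, by simpa using h1, ?_⟩
    rw [Finset.sum_range]
    simp

lemma norm_rpow_mem_varSums {a b : ℝ} (hab : a ≤ b) : ‖x b - x a‖ ^ p ∈ varSums p x a b := by
  refine mem_varSums_iff.2 ⟨1, fun i => if i = 0 then a else b, fun i j hij => ?_, by simp,
    by simp, by simp⟩
  dsimp only
  split_ifs with h1 h2 h2
  · exact le_rfl
  · exact hab
  · omega
  · exact le_rfl

lemma nonneg_of_mem_varSums {a b v : ℝ} (h : v ∈ varSums p x a b) : 0 ≤ v := by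
  obtain ⟨n, u, -, -, -, rfl⟩ := mem_varSums_iff.1 h
  positivity

lemma add_mem_varSums {a b c v v' : ℝ} (h : v ∈ varSums p x a b) (h' : v' ∈ varSums p x b c) :
    v + v' ∈ varSums p x a c := by
  obtain ⟨n, u, hu, hu0, hun, rfl⟩ := mem_varSums_iff.1 h
  obtain ⟨m, r, hr, hr0, hrm, rfl⟩ := mem_varSums_iff.1 h'
  refine mem_varSums_iff.2 ⟨n + m, fun i => if i ≤ n then u i else r (i - n), ?_, by simpa, ?_, ?_⟩
  · refine monotone_nat_of_le_succ fun i => ?_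
    split_ifs with h1 h2 h2
    · exact hu (by omega)
    · obtain rfl : i = n := by omega
      rw [hun, ← hr0]
      exact hr (by omega)
    · omega
    · exact hr (by omega)
  · dsimp only
    split_ifs with h1
    · obtain rfl : m = 0 := by omega
      rw [← hrm, hr0]; simpa using hun
    · simpa using hrm
  · rw [Finset.sum_range_add]
    congr 1
    · refine Finset.sum_congr rfl fun i hi => ?_
      have := Finset.mem_range.1 hi
      simp only [if_pos (show i + 1 ≤ n by omega), if_pos (show i ≤ n by omega)]
    · refine Finset.sum_congr rfl fun i hi => ?_
      have e1 : ¬ n + i + 1 ≤ n := by omega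
      have e2 : n + i + 1 - n = i + 1 := by omega
      simp only [if_neg e1, e2]
      rcases Nat.eq_zero_or_pos i with rfl | h0
      · simp [hun, hr0]
      · have e3 : ¬ n + i ≤ n := by omega
        simp only [if_neg e3, Nat.add_sub_cancel_left]

lemma HasFinVar.subinterval {a b c e : ℝ} (h : HasFinVar p x a e) (hab : a ≤ b) (hce : c ≤ e) :
    HasFinVar p x b c := by
  obtain ⟨M, hM⟩ := h
  refine ⟨M, fun v hv => ?_⟩
  have h1 := norm_rpow_mem_varSums (p := p) (x := x) hab
  have h2 := norm_rpow_mem_varSums (p := p) (x := x) hce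
  have := hM (add_mem_varSums (add_mem_varSums h1 hv) h2)
  have := nonneg_of_mem_varSums h1
  have := nonneg_of_mem_varSums h2
  linarith

lemma isTimeControl_vpvar (h : ∀ T : ℝ, 0 ≤ T → HasFinVar p x 0 T) :
    IsTimeControl (vpvar p x) where
  nonneg _ _ := Real.sSup_nonneg fun _ hv => nonneg_of_mem_varSums hv
  superadd {s t r} h0 h1 h2 := by
    have hB : HasFinVar p x s r := (h r (by linarith)).subinterval h0 le_rfl
    have key : ∀ v ∈ varSums p x s t, ∀ v' ∈ varSums p x t r, v + v' ≤ vpvar p x s r :=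
      fun v hv v' hv' => le_csSup hB (add_mem_varSums hv hv')
    have : ∀ v ∈ varSums p x s t, v ≤ vpvar p x s r - vpvar p x t r := fun v hv => by
      have : vpvar p x t r ≤ vpvar p x s r - v :=
        csSup_le ⟨_, norm_rpow_mem_varSums h2⟩ fun v' hv' => by linarith [key v hv v' hv']
      linarith
    have : vpvar p x s t ≤ vpvar p x s r - vpvar p x t r :=
      csSup_le ⟨_, norm_rpow_mem_varSums h1⟩ this
    linarith

lemma norm_sub_rpow_le_vpvar (h : ∀ T : ℝ, 0 ≤ T → HasFinVar p x 0 T) {s t : ℝ} (h0 : 0 ≤ s)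
    (hst : s ≤ t) : ‖x t - x s‖ ^ p ≤ vpvar p x s t :=
  le_csSup ((h t (h0.trans hst)).subinterval h0 le_rfl) (norm_rpow_mem_varSums hst)

lemma IsTimeControl.exists_left_small {w : ℝ → ℝ → ℝ} (hw : IsTimeControl w) {t ε : ℝ}
    (ht : 0 < t) (hε : 0 < ε) : ∃ s, 0 ≤ s ∧ s < t ∧ ∀ r, s ≤ r → r < t → w s r ≤ ε := by
  set S := (fun s => w 0 s) '' Ico 0 t
  have hB : BddAbove S := ⟨w 0 t, by
    rintro _ ⟨s, hs, rfl⟩; exact hw.mono le_rfl le_rfl hs.1 hs.2.le⟩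
  have hne : S.Nonempty := ⟨w 0 0, 0, ⟨le_rfl, ht⟩, rfl⟩
  obtain ⟨_, ⟨s, hs, rfl⟩, h1⟩ := exists_lt_of_lt_csSup hne (sub_lt_self (sSup S) hε)
  refine ⟨s, hs.1, hs.2, fun r h2 h3 => ?_⟩
  have e1 : w 0 r ≤ sSup S := le_csSup hB ⟨r, ⟨hs.1.trans h2, h3⟩, rfl⟩
  have e2 := hw.superadd le_rfl hs.1 h2
  dsimp only at h1
  linarith

lemma IsTimeControl.exists_right_small_open {w : ℝ → ℝ → ℝ} (hw : IsTimeControl w) {t ε : ℝ}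
    (ht : 0 ≤ t) (hε : 0 < ε) : ∃ u, t < u ∧ ∀ r r', t < r → r ≤ r' → r' ≤ u → w r r' ≤ ε := by
  set S := (fun s => w s (t + 1)) '' Ioc t (t + 1)
  have hB : BddAbove S := ⟨w t (t + 1), by
    rintro _ ⟨s, hs, rfl⟩; exact hw.mono ht hs.1.le hs.2 le_rfl⟩
  have hne : S.Nonempty := ⟨w (t + 1) (t + 1), t + 1, ⟨by linarith, le_rfl⟩, rfl⟩
  obtain ⟨_, ⟨u, hu, rfl⟩, h1⟩ := exists_lt_of_lt_csSup hne (sub_lt_self (sSup S) hε)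
  refine ⟨u, hu.1, fun r r' h2 h3 h4 => ?_⟩
  have e1 : w r (t + 1) ≤ sSup S := le_csSup hB ⟨r, ⟨h2, (h3.trans h4).trans hu.2⟩, rfl⟩
  have e2 := hw.superadd (ht.trans h2.le) (h3.trans h4) hu.2
  have e3 := hw.mono (ht.trans h2.le) le_rfl h3 h4
  dsimp only at h1
  linarith

lemma exists_right_small_vpvar (hp : 0 < p) (h : ∀ T : ℝ, 0 ≤ T → HasFinVar p x 0 T) {t ε : ℝ}
    (hx : ContinuousWithinAt x (Ici t) t) (ht : 0 ≤ t) (hε : 0 < ε) :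
    ∃ u, t < u ∧ ∀ r, t ≤ r → r < u → vpvar p x t r ≤ ε := by
  have hw := isTimeControl_vpvar h
  obtain ⟨u₁, hu₁, h1⟩ := hw.exists_right_small_open ht (half_pos hε)
  have hη : 0 < (ε / 2) ^ (1 / p) := by positivity
  obtain ⟨δ, hδ, h2⟩ := Metric.continuousWithinAt_iff.1 hx _ hη
  have hx' : ∀ r, t ≤ r → r < t + δ → ‖x r - x t‖ ^ p ≤ ε / 2 := fun r hr hr' => by
    have := h2 (show r ∈ Ici t from hr) (by rw [Real.dist_eq, abs_of_nonneg] <;> linarith)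
    rw [dist_eq_norm] at this
    calc ‖x r - x t‖ ^ p ≤ ((ε / 2) ^ (1 / p)) ^ p := by gcongr
      _ = ε / 2 := by
        rw [← Real.rpow_mul (by positivity), one_div_mul_cancel hp.ne', Real.rpow_one]
  refine ⟨min u₁ (t + δ), lt_min hu₁ (by linarith), fun r hr hru => ?_⟩
  have hr1 := hru.trans_le (min_le_left _ _)
  have hr2 := hru.trans_le (min_le_right _ _)
  refine csSup_le ⟨_, norm_rpow_mem_varSums hr⟩ fun v hv => ?_
  obtain ⟨n, u, hu, hu0, hun, rfl⟩ := mem_varSums_iff.1 hv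
  clear hv
  induction n generalizing u with
  | zero => simpa using hε.le
  | succ n ih =>
    rw [Finset.sum_range_succ']
    rcases eq_or_lt_of_le (hu0 ▸ hu (Nat.zero_le 1) : t ≤ u 1) with h3 | h3
    · have := ih (fun i => u (i + 1)) (fun i j hij => hu (by omega)) h3.symm hun
      simp only [zero_add, ← h3, hu0, sub_self, norm_zero, Real.zero_rpow hp.ne', add_zero]
      exact this
    · have hur : u 1 ≤ r := hun ▸ hu (by omega)
      have e1 : ∑ i ∈ Finset.range n, ‖x (u (i + 1 + 1)) - x (u (i + 1))‖ ^ p ≤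
          vpvar p x (u 1) r :=
        le_csSup ((h r (ht.trans hr)).subinterval (ht.trans h3.le) le_rfl)
          (mem_varSums_iff.2 ⟨n, fun i => u (i + 1), fun i j hij => hu (by omega), rfl, hun, rfl⟩)
      have e2 := h1 (u 1) r h3 hur hr1.le
      have e3 := hx' (u 1) h3.le (hur.trans_lt hr2)
      rw [← hu0] at e3
      simp only [zero_add]
      linarith

lemma Cadlag.exists_right_small (hx : Cadlag x) (t : ℝ) {ε : ℝ} (hε : 0 < ε) :
    ∃ u, t < u ∧ ∀ r r', t ≤ r → r ≤ r' → r' < u → ‖x r' - x r‖ ≤ ε := by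
  obtain ⟨δ, hδ, h2⟩ := Metric.continuousWithinAt_iff.1 (hx.1 t) _ (half_pos hε)
  refine ⟨t + δ, by linarith, fun r r' h3 h4 h5 => ?_⟩
  have e1 := h2 (show r ∈ Ici t from h3) (by rw [Real.dist_eq, abs_of_nonneg] <;> linarith)
  have e2 := h2 (show r' ∈ Ici t from h3.trans h4)
    (by rw [Real.dist_eq, abs_of_nonneg] <;> linarith)
  rw [← dist_eq_norm]
  linarith [dist_triangle_right (x r') (x r) (x t)]

lemma Cadlag.exists_left_small (hx : Cadlag x) (t : ℝ) {ε : ℝ} (hε : 0 < ε) :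
    ∃ s, s < t ∧ ∀ r r', s < r → r ≤ r' → r' < t → ‖x r' - x r‖ ≤ ε := by
  obtain ⟨c, hc⟩ := hx.2 t
  obtain ⟨δ, hδ, h2⟩ := Metric.tendsto_nhdsWithin_nhds.1 hc _ (half_pos hε)
  refine ⟨t - δ, by linarith, fun r r' h3 h4 h5 => ?_⟩
  have e1 := h2 (show r ∈ Iio t from h4.trans_lt h5)
    (by rw [Real.dist_eq, abs_of_nonpos] <;> linarith)
  have e2 := h2 (show r' ∈ Iio t from h5)
    (by rw [Real.dist_eq, abs_of_nonpos] <;> linarith)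
  rw [← dist_eq_norm]
  linarith [dist_triangle_right (x r') (x r) c]

end Variation

/-- No point of `F` separates `s` from `t`. -/
def SameCell (F : Finset ℝ) (s t : ℝ) : Prop := ∀ ρ ∈ F, ¬(s < ρ ∧ ρ ≤ t)

lemma SameCell.mono {F : Finset ℝ} {s s' t t' : ℝ} (h : SameCell F s t) (hs : s ≤ s')
    (ht : t' ≤ t) : SameCell F s' t' := fun ρ hρ h' => h ρ hρ ⟨hs.trans_lt h'.1, h'.2.trans ht⟩

lemma SameCell.subset {F F' : Finset ℝ} {s t : ℝ} (h : SameCell F s t) (hF : F' ⊆ F) :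
    SameCell F' s t := fun ρ hρ => h ρ (hF hρ)

lemma exists_finset_cells {Q : ℝ → ℝ → Prop}
    (hr : ∀ t, 0 ≤ t → ∃ u, t < u ∧ ∀ r r', t ≤ r → r ≤ r' → r' < u → Q r r')
    (hl : ∀ t, 0 < t → ∃ s, s < t ∧ ∀ r r', s < r → r ≤ r' → r' < t → Q r r') (T : ℝ) :
    ∃ F : Finset ℝ, (∀ ρ ∈ F, 0 < ρ) ∧
      ∀ r r', 0 ≤ r → r ≤ r' → r ≤ T → SameCell F r r' → Q r r' := by
  suffices ∃ F : Finset ℝ, ∀ r r', 0 ≤ r → r ≤ r' → r ∈ Icc 0 T → SameCell F r r' → Q r r' by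
    obtain ⟨F, hF⟩ := this
    refine ⟨F.filter (0 < ·), fun ρ hρ => (Finset.mem_filter.1 hρ).2, fun r r' h0 h1 h2 h3 =>
      hF r r' h0 h1 ⟨h0, h2⟩ fun ρ hρ h => h3 ρ (Finset.mem_filter.2 ⟨hρ, ?_⟩) h⟩
    exact h0.trans_lt h.1
  refine isCompact_Icc.induction_on (p := fun S => ∃ F : Finset ℝ, ∀ r r', 0 ≤ r → r ≤ r' →
    r ∈ S → SameCell F r r' → Q r r') ?_ ?_ ?_ ?_
  · exact ⟨∅, fun _ _ _ _ h => absurd h (notMem_empty _)⟩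
  · rintro S S' hS ⟨F, hF⟩
    exact ⟨F, fun r r' h0 h1 h2 => hF r r' h0 h1 (hS h2)⟩
  · rintro S S' ⟨F, hF⟩ ⟨F', hF'⟩
    classical
    refine ⟨F ∪ F', fun r r' h0 h1 h2 h3 => ?_⟩
    rcases h2 with h2 | h2
    · exact hF r r' h0 h1 h2 (h3.subset Finset.subset_union_left)
    · exact hF' r r' h0 h1 h2 (h3.subset Finset.subset_union_right)
  · rintro t ⟨ht0, -⟩
    obtain ⟨u, htu, hu⟩ := hr t ht0
    obtain ⟨s, hst, hs⟩ : ∃ s, s < t ∧ ∀ r r', 0 ≤ r → s < r → r ≤ r' → r' < t → Q r r' := by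
      rcases ht0.eq_or_lt with rfl | h
      · exact ⟨-1, by norm_num, fun r r' h1 h2 h3 h4 => by linarith⟩
      · obtain ⟨s, h1, h2⟩ := hl t h
        exact ⟨s, h1, fun r r' _ => h2 r r'⟩
    refine ⟨Ioo s u, mem_nhdsWithin_of_mem_nhds (Ioo_mem_nhds hst htu), {t, u},
      fun r r' h0 h1 h2 h3 => ?_⟩
    rcases lt_or_ge r t with h | h
    · refine hs r r' h0 h2.1 h1 (lt_of_not_ge fun h4 => h3 t (by simp) ⟨h, h4⟩)
    · exact hu r r' h h1 (lt_of_not_ge fun h4 => h3 u (by simp) ⟨h2.2, h4⟩)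

/-- The drivers `a`, `z` are controlled by `w`, and `w` and the barrier `l` have small
oscillation on the cells of suitable finite partitions. -/
structure IsDriver {d : ℕ} (p : ℝ) (a : ℝ → ℝ) (z l : ℝ → Eu d) (w : ℝ → ℝ → ℝ) : Prop where
  ctrl : IsTimeControl w
  abs_a : ∀ {s t : ℝ}, 0 ≤ s → s ≤ t → |a t - a s| ≤ w s t
  norm_z : ∀ {s t : ℝ}, 0 ≤ s → s ≤ t → ‖z t - z s‖ ≤ w s t ^ (1 / p)
  cells : ∀ (T : ℝ) {ε : ℝ}, 0 < ε → ∃ F : Finset ℝ, (∀ ρ ∈ F, 0 < ρ) ∧ ∀ r r', 0 ≤ r →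
    r ≤ r' → r ≤ T → SameCell F r r' → w r r' ≤ ε ∧ ‖l r' - l r‖ ≤ ε

theorem exists_isDriver {d : ℕ} {p : ℝ} (hp : 1 ≤ p) {a : ℝ → ℝ} {z l : ℝ → Eu d}
    (ha : Cadlag a) (hz : Cadlag z) (hl : Cadlag l)
    (hav : ∀ T : ℝ, 0 ≤ T → HasFinVar 1 a 0 T) (hzv : ∀ T : ℝ, 0 ≤ T → HasFinVar p z 0 T) :
    ∃ w, IsDriver p a z l w := by
  have hp0 : 0 < p := by linarith
  have ca := isTimeControl_vpvar hav
  have cz := isTimeControl_vpvar hzv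
  have hw := ca.add cz
  refine ⟨_, hw, fun {s t} h0 h1 => ?_, fun {s t} h0 h1 => ?_, fun T ε hε =>
    exists_finset_cells (fun t ht => ?_) (fun t ht => ?_) T⟩
  · have := norm_sub_rpow_le_vpvar hav h0 h1
    rw [Real.rpow_one, Real.norm_eq_abs] at this
    have := cz.nonneg h0 h1
    linarith
  · have := norm_sub_rpow_le_vpvar hzv h0 h1
    have := ca.nonneg h0 h1
    rw [one_div, Real.le_rpow_inv_iff_of_pos (norm_nonneg _) (hw.nonneg h0 h1) hp0]
    linarith
  · obtain ⟨u₁, h1, h1'⟩ := exists_right_small_vpvar one_pos hav (ha.1 t) ht (half_pos hε)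
    obtain ⟨u₂, h2, h2'⟩ := exists_right_small_vpvar hp0 hzv (hz.1 t) ht (half_pos hε)
    obtain ⟨u₃, h3, h3'⟩ := hl.exists_right_small t hε
    refine ⟨min u₁ (min u₂ u₃), by simp [h1, h2, h3], fun r r' h4 h5 h6 => ⟨?_, ?_⟩⟩
    · simp only [lt_min_iff] at h6
      have := h1' r' (h4.trans h5) h6.1
      have := h2' r' (h4.trans h5) h6.2.1
      have := hw.mono ht h4 h5 le_rfl
      linarith
    · simp only [lt_min_iff] at h6
      exact h3' r r' h4 h5 h6.2.2
  · obtain ⟨s₁, h0, h1, h1'⟩ := hw.exists_left_small ht hε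
    obtain ⟨s₂, h2, h2'⟩ := hl.exists_left_small t hε
    refine ⟨max s₁ s₂, by simp [h1, h2], fun r r' h4 h5 h6 => ⟨?_, ?_⟩⟩
    · simp only [max_lt_iff] at h4
      exact (hw.mono h0 h4.1.le h5 le_rfl).trans (h1' r' (h4.1.le.trans h5) h6)
    · simp only [max_lt_iff] at h4
      exact h2' r r' h4.2 h5 h6

/-- The standing assumptions on the coefficients. -/
structure IsCoeff {d : ℕ} (p α L Cα : ℝ) (f : Eu d → Eu d) (g : Eu d → (Eu d →L[ℝ] Eu d)) :
    Prop where
  one_le : 1 ≤ p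
  lt_exp : p - 1 < α
  exp_le : α ≤ 1
  pos_L : 0 < L
  pos_C : 0 < Cα
  cont : Continuous f
  growth : ∀ u : Eu d, ‖f u‖ ≤ L * (1 + ‖u‖)
  holder : ∀ u v : Eu d, ‖g u - g v‖ ≤ Cα * ‖u - v‖ ^ α

/-- The Euler recursion along the grid of step `1 / n`. -/
abbrev IsGridEuler {d : ℕ} (f : Eu d → Eu d) (g : Eu d → (Eu d →L[ℝ] Eu d)) (a : ℝ → ℝ)
    (z l : ℝ → Eu d) (n : ℕ) (x y : ℕ → Eu d) : Prop :=
  IsEuler f g (fun j : ℕ => a ((j : ℝ) / n)) (fun j : ℕ => z ((j : ℝ) / n))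
    (fun j : ℕ => l ((j : ℝ) / n)) x y

/-- The number of points of `F` that are at most `s`. -/
def cellIndex (F : Finset ℝ) (s : ℝ) : ℕ := (F.filter (· ≤ s)).card

lemma cellIndex_mono (F : Finset ℝ) : Monotone (cellIndex F) := fun _ _ h =>
  Finset.card_le_card fun _ hx => Finset.mem_filter.2
    ⟨(Finset.mem_filter.1 hx).1, (Finset.mem_filter.1 hx).2.trans h⟩

lemma cellIndex_le_card (F : Finset ℝ) (s : ℝ) : cellIndex F s ≤ F.card :=
  Finset.card_le_card (Finset.filter_subset _ _)

lemma cellIndex_lt {F : Finset ℝ} {s t ρ : ℝ} (hρ : ρ ∈ F) (h1 : s < ρ) (h2 : ρ ≤ t) :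
    cellIndex F s < cellIndex F t := by
  refine Finset.card_lt_card (Finset.ssubset_iff_of_subset (fun x hx => ?_) |>.2 ⟨ρ, ?_, ?_⟩)
  · simp only [Finset.mem_filter] at hx ⊢
    exact ⟨hx.1, hx.2.trans (h1.le.trans h2)⟩
  · simp [hρ, h2]
  · simp [h1]

lemma cellIndex_lt_of_not_sameCell {F : Finset ℝ} {s t : ℝ} (h : ¬ SameCell F s t) :
    cellIndex F s < cellIndex F t := by
  unfold SameCell at h
  push Not at h
  obtain ⟨ρ, hρ, h1, h2⟩ := h
  exact cellIndex_lt hρ h1 h2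

lemma exists_cell_start (F : Finset ℝ) {t : ℝ} (ht : 0 ≤ t) :
    ∃ s ∈ insert 0 F, 0 ≤ s ∧ s ≤ t ∧ SameCell F s t := by
  have hne : ((insert 0 F).filter fun s => 0 ≤ s ∧ s ≤ t).Nonempty := ⟨0, by simp [ht]⟩
  obtain ⟨s, hs, hmax⟩ := Finset.exists_max_image _ id hne
  rw [Finset.mem_filter] at hs
  refine ⟨s, hs.1, hs.2.1, hs.2.2, fun ρ hρ h => ?_⟩
  have := hmax ρ (by simp [hρ, h.2]; linarith)
  simp only [id] at this
  linarith

/-- Growth across cells, by induction. -/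
lemma le_pow_cellIndex {q : ℕ → ℝ} {K T : ℝ} {F : Finset ℝ} {n : ℕ} (hq : 0 ≤ q 0)
    (hK : 1 ≤ K)
    (hblock : ∀ b e : ℕ, b ≤ e → (e : ℝ) / n ≤ T → SameCell F ((b : ℝ) / n) ((e : ℝ) / n) →
      q e ≤ K * q b)
    (hstep : ∀ j : ℕ, ((j + 1 : ℕ) : ℝ) / n ≤ T → q (j + 1) ≤ K * q j) (j : ℕ)
    (hj : (j : ℝ) / n ≤ T) : q j ≤ q 0 * K ^ (2 * cellIndex F ((j : ℝ) / n) + 1) := by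
  induction j using Nat.strong_induction_on with
  | _ j ih =>
  have hK0 : 0 ≤ K := by linarith
  classical
  have hex : ∃ b, b ≤ j ∧ SameCell F ((b : ℝ) / n) ((j : ℝ) / n) :=
    ⟨j, le_rfl, fun ρ _ h => by linarith [h.1, h.2]⟩
  obtain ⟨hbj, hb⟩ := Nat.find_spec hex
  have hmin := fun m => Nat.find_min (m := m) hex
  set b := Nat.find hex
  have h1 := hblock b j hbj hj hb
  rcases Nat.eq_zero_or_pos b with h0 | h0
  · rw [h0] at h1
    calc q j ≤ q 0 * K := by linarith
      _ ≤ q 0 * K ^ (2 * cellIndex F ((j : ℝ) / n) + 1) := by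
        gcongr; exact le_self_pow₀ hK (by omega)
  · obtain ⟨c, hc⟩ : ∃ c, b = c + 1 := ⟨b - 1, by omega⟩
    have h2 : ¬ SameCell F ((c : ℝ) / n) ((j : ℝ) / n) := fun h =>
      hmin c (by omega) ⟨by omega, h⟩
    have h3 := cellIndex_lt_of_not_sameCell h2
    have hbT : (b : ℝ) / n ≤ T := le_trans (by gcongr) hj
    have h4 := hstep c (by rw [← hc]; exact hbT)
    have h5 := ih c (by omega) (le_trans (by gcongr; omega) hj)
    rw [hc] at h1
    calc q j ≤ K * (K * q c) := h1.trans (by gcongr)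
      _ ≤ K * (K * (q 0 * K ^ (2 * cellIndex F ((c : ℝ) / n) + 1))) := by gcongr
      _ = q 0 * K ^ (2 * cellIndex F ((c : ℝ) / n) + 3) := by ring
      _ ≤ _ := mul_le_mul_of_nonneg_left (pow_le_pow_right₀ hK (by omega)) hq

section Uniform

variable {d : ℕ} {p α L Cα : ℝ} {f : Eu d → Eu d} {g : Eu d → (Eu d →L[ℝ] Eu d)}
  {a : ℝ → ℝ} {z l : ℝ → Eu d} {w : ℝ → ℝ → ℝ}

lemma IsDriver.exists_bound_l (hD : IsDriver p a z l w) (T : ℝ) :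
    ∃ M, 0 ≤ M ∧ ∀ t, 0 ≤ t → t ≤ T → ‖l t‖ ≤ M := by
  obtain ⟨F, -, hF⟩ := hD.cells T one_pos
  refine ⟨1 + ∑ s ∈ insert 0 F, ‖l s‖, by positivity, fun t h0 h1 => ?_⟩
  obtain ⟨s, hs, hs0, hst, hc⟩ := exists_cell_start F h0
  have h2 := (hF s t hs0 hst (hst.trans h1) hc).2
  have h3 := Finset.single_le_sum (f := fun s => ‖l s‖) (fun i _ => norm_nonneg _) hs
  have h4 := norm_le_norm_add_norm_sub' (l t) (l s)
  linarith

lemma norm_increment_le (hc : IsCoeff p α L Cα f g) {a₀ a₁ W : ℝ} {z₀ z₁ : Eu d} (u : Eu d)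
    (ha : |a₁ - a₀| ≤ W) (hz : ‖z₁ - z₀‖ ≤ W ^ (1 / p)) (hW : 0 ≤ W) :
    ‖(a₁ - a₀) • f u + g u (z₁ - z₀)‖ ≤
      (W * L + (‖g 0‖ + Cα) * W ^ (1 / p)) * (1 + ‖u‖) := by
  have h1 : ‖(a₁ - a₀) • f u‖ ≤ W * (L * (1 + ‖u‖)) := by
    rw [norm_smul, Real.norm_eq_abs]
    have := hc.growth u
    gcongr
  have h2 : ‖g u (z₁ - z₀)‖ ≤ ((‖g 0‖ + Cα) * (1 + ‖u‖)) * W ^ (1 / p) := by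
    refine (ContinuousLinearMap.le_opNorm _ _).trans ?_
    have h3 := hc.one_le
    have h4 := hc.lt_exp
    have := norm_coeff_le (by linarith) hc.exp_le hc.pos_C.le hc.holder u
    have := hc.pos_C
    gcongr
  calc _ ≤ _ := norm_add_le _ _
    _ ≤ _ := add_le_add h1 h2
    _ = _ := by ring

theorem exists_apriori_bound (hc : IsCoeff p α L Cα f g) (hD : IsDriver p a z l w) (x0 : Eu d)
    (T : ℝ) (hT : 0 ≤ T) :
    ∃ (M A : ℝ) (F : Finset ℝ), 0 ≤ M ∧ 0 ≤ A ∧ (∀ ρ ∈ F, 0 < ρ) ∧ ∀ (n : ℕ) (x y : ℕ → Eu d),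
      IsGridEuler f g a z l n x y → x 0 = x0 →
      (∀ j : ℕ, (j : ℝ) / n ≤ T → ‖x j‖ ≤ M ∧ ‖y j‖ ≤ M) ∧
      ∀ i k : ℕ, i ≤ k → (k : ℝ) / n ≤ T → SameCell F ((i : ℝ) / n) ((k : ℝ) / n) →
        ‖y k - y i‖ ≤ A * w ((i : ℝ) / n) ((k : ℝ) / n) ^ (1 / p) := by
  have hp := hc.one_le
  have hp0 : 0 < p := by linarith
  have hC1 : 0 < blockConst d p α L Cα g := blockConst_pos hp hc.lt_exp hc.pos_L hc.pos_C
  set C1 := blockConst d p α L Cα g with hC1def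
  have hε : 0 < min 1 ((1 / (2 * C1)) ^ p) := by positivity
  obtain ⟨F, hF0, hF⟩ := hD.cells T hε
  set ε := min 1 ((1 / (2 * C1)) ^ p)
  have hε1 : ε ≤ 1 := min_le_left _ _
  have hε2 : ε ^ (1 / p) ≤ 1 / (2 * C1) := by
    calc ε ^ (1 / p) ≤ ((1 / (2 * C1)) ^ p) ^ (1 / p) := by gcongr; exact min_le_right _ _
      _ = _ := by rw [← Real.rpow_mul (by positivity), mul_one_div_cancel hp0.ne', Real.rpow_one]
  obtain ⟨Lb, hLb0, hLb⟩ := hD.exists_bound_l T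
  have hW : 0 ≤ w 0 T := hD.ctrl.nonneg le_rfl hT
  set C2 := w 0 T * L + (‖g 0‖ + Cα) * w 0 T ^ (1 / p) with hC2
  have hC20 : 0 ≤ C2 := by
    have := hc.pos_L; have := hc.pos_C; positivity
  set K := (3 + 2 * (d : ℝ)) + (2 * C2 + 2 * Lb) with hK
  have hK1 : 1 ≤ K := by have : (0 : ℝ) ≤ d := by positivity
                         linarith
  set M := (1 + ‖x0‖ + ‖x0‖) * K ^ (2 * F.card + 1) with hM
  have hM0 : 0 ≤ M := by positivity
  refine ⟨M, 2 * C1 * (1 + M), F, hM0, by positivity, hF0, fun n x y h hx0 => ?_⟩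
  have hy0 : y 0 = x0 := h.y_zero.trans hx0
  have hn0 : ∀ j : ℕ, 0 ≤ (j : ℝ) / n := fun j => by positivity
  have hblock : ∀ b e : ℕ, b ≤ e → (e : ℝ) / n ≤ T →
      SameCell F ((b : ℝ) / n) ((e : ℝ) / n) → ∀ i k, b ≤ i → i ≤ k → k ≤ e →
      ‖y k - y i‖ ≤ 2 * C1 * (1 + ‖x b‖) * w ((i : ℝ) / n) ((k : ℝ) / n) ^ (1 / p) := by
    intro b e hbe heT hcell
    have hbe' : (b : ℝ) / n ≤ (e : ℝ) / n := by gcongr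
    have hwe := (hF _ _ (hn0 b) hbe' (hbe'.trans heT) hcell).1
    refine h.norm_y_sub_le_block (w := fun i j => w ((i : ℝ) / n) ((j : ℝ) / n)) hp hc.lt_exp
      hc.exp_le hc.pos_L hc.pos_C hc.growth hc.holder (hD.ctrl.grid n) b e hbe
      (fun i j hij _ => hD.norm_z (hn0 i) (by gcongr))
      (fun i j hij _ => hD.abs_a (hn0 i) (by gcongr)) (hwe.trans hε1)
      (le_trans (Real.rpow_le_rpow (hD.ctrl.nonneg (hn0 b) hbe') hwe (by positivity)) hε2)
      (fun j h1 h2 => ((hF _ _ (hn0 b) (by gcongr) (hbe'.trans heT)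
        (hcell.mono le_rfl (by gcongr))).2).trans hε1)
  have hbound : ∀ j : ℕ, (j : ℝ) / n ≤ T → 1 + ‖x j‖ + ‖y j‖ ≤ M := by
    intro j hj
    refine (le_pow_cellIndex (q := fun j => 1 + ‖x j‖ + ‖y j‖) (F := F) (n := n) (T := T)
      (by positivity) hK1 ?_ ?_ j hj).trans ?_
    · intro b e hbe heT hcell
      have hbe' : (b : ℝ) / n ≤ (e : ℝ) / n := by gcongr
      have hwe := (hF _ _ (hn0 b) hbe' (hbe'.trans heT) hcell).1
      have hy : ∀ j, b ≤ j → j ≤ e → ‖y j - y b‖ ≤ 1 + ‖x b‖ := fun j h1 h2 => by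
        have hwj : w ((b : ℝ) / n) ((j : ℝ) / n) ^ (1 / p) ≤ 1 / (2 * C1) := by
          refine le_trans (Real.rpow_le_rpow (hD.ctrl.nonneg (hn0 b) (by gcongr)) ?_
            (by positivity)) hε2
          exact (hD.ctrl.mono (hn0 b) le_rfl (by gcongr) (by gcongr)).trans hwe
        calc ‖y j - y b‖ ≤ _ := hblock b e hbe heT hcell b j le_rfl h1 h2
          _ ≤ 2 * C1 * (1 + ‖x b‖) * (1 / (2 * C1)) := by gcongr
          _ = 1 + ‖x b‖ := by field_simp
      have hl : ∀ j, b ≤ j → j ≤ e → ‖l ((j : ℝ) / n) - l ((b : ℝ) / n)‖ ≤ 1 := fun j h1 h2 =>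
        ((hF _ _ (hn0 b) (by gcongr) (hbe'.trans heT) (hcell.mono le_rfl (by gcongr))).2).trans hε1
      have e1 := h.norm_x_sub_le hbe
      have e2 := h.totalReg_sub_le hbe hl hy
      have e3 := hy e hbe le_rfl
      have e4 := norm_le_norm_add_norm_sub' (x e) (x b)
      have e5 := norm_le_norm_add_norm_sub' (y e) (y b)
      have e6 : (d : ℝ) * (1 + (1 + ‖x b‖)) ≤ 2 * d * (1 + ‖x b‖ + ‖y b‖) := by
        have : (0 : ℝ) ≤ d := by positivity
        nlinarith [mul_nonneg this (norm_nonneg (x b)), mul_nonneg this (norm_nonneg (y b))]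
      have e7 : 0 ≤ (2 * C2 + 2 * Lb) * (1 + ‖x b‖ + ‖y b‖) := by positivity
      simp only [hK]
      have e8 := norm_nonneg (y b)
      linarith
    · intro j hj
      have hj' : (j : ℝ) / n ≤ ((j + 1 : ℕ) : ℝ) / n := by gcongr; omega
      have hwj : w ((j : ℝ) / n) (((j + 1 : ℕ) : ℝ) / n) ≤ w 0 T :=
        hD.ctrl.mono le_rfl (hn0 j) hj' hj
      have hwj0 := hD.ctrl.nonneg (hn0 j) hj'
      have e1 : ‖y (j + 1) - y j‖ ≤ C2 * (1 + ‖x j‖) := by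
        have := h.y_succ j
        rw [this, add_sub_cancel_left]
        exact norm_increment_le hc _ ((hD.abs_a (hn0 j) hj').trans hwj)
          ((hD.norm_z (hn0 j) hj').trans (by gcongr)) hW
      have e2 := h.norm_x_succ_le j
      have e3 := hLb _ (hn0 (j + 1)) hj
      have e5 := norm_le_norm_add_norm_sub' (y (j + 1)) (y j)
      simp only [hK]
      have e6 : 0 ≤ C2 * ‖y j‖ := by positivity
      have e7 : 0 ≤ Lb * (‖x j‖ + ‖y j‖) := by positivity
      have e8 : 0 ≤ (2 + 2 * (d : ℝ)) * (1 + ‖x j‖ + ‖y j‖) := by positivity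
      nlinarith
    · simp only [hx0, hy0, hM]
      gcongr
      exact cellIndex_le_card _ _
  refine ⟨fun j hj => ?_, fun i k hik hk hcell => ?_⟩
  · have := hbound j hj
    have := norm_nonneg (x j)
    have := norm_nonneg (y j)
    constructor <;> linarith
  · have h1 := hbound i (le_trans (by gcongr) hk)
    have h2 := norm_nonneg (y i)
    refine (hblock i k hik hk hcell i k le_rfl hik le_rfl).trans ?_
    have := hD.ctrl.nonneg (hn0 i) (show (i : ℝ) / n ≤ (k : ℝ) / n by gcongr)
    gcongr
    linarith

end Uniform

section UniformControl

variable {d : ℕ} {p α L Cα : ℝ} {f : Eu d → Eu d} {g : Eu d → (Eu d →L[ℝ] Eu d)}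
  {a : ℝ → ℝ} {z l : ℝ → Eu d} {w : ℝ → ℝ → ℝ}

/-- Bounds for the Euler recursion on the grid of step `1 / n`, up to time `T`, in terms of a
discrete control `Ω`. -/
structure EulerControl {d : ℕ} (p T M B : ℝ) (n : ℕ) (x y : ℕ → Eu d) (Ω : ℕ → ℕ → ℝ) :
    Prop where
  ctrl : IsControl Ω
  norm_x : ∀ j : ℕ, (j : ℝ) / n ≤ T → ‖x j‖ ≤ M
  norm_y : ∀ j : ℕ, (j : ℝ) / n ≤ T → ‖y j‖ ≤ M
  norm_x_sub : ∀ i k : ℕ, i ≤ k → (k : ℝ) / n ≤ T → ‖x k - x i‖ ≤ Ω i k ^ (1 / p)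
  total : ∀ k : ℕ, (k : ℝ) / n ≤ T → Ω 0 k ≤ B

/-- Oscillation bounds by `η` between any two times up to `T` in the same cell of `P`. -/
structure CellBound {d : ℕ} (p T η : ℝ) (l : ℝ → Eu d) (w : ℝ → ℝ → ℝ)
    (x y : ℕ → ℕ → Eu d) (Ω : ℕ → ℕ → ℕ → ℝ) (P : Finset ℝ) : Prop where
  driver : ∀ r r', 0 ≤ r → r ≤ r' → r ≤ T → SameCell P r r' → w r r' ≤ η ∧ ‖l r' - l r‖ ≤ η
  euler : ∀ n i k : ℕ, i ≤ k → (k : ℝ) / n ≤ T → SameCell P ((i : ℝ) / n) ((k : ℝ) / n) →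
    Ω n i k ≤ η ∧ ‖y n k - y n i‖ ≤ η

theorem exists_eulerControl (hc : IsCoeff p α L Cα f g) (hD : IsDriver p a z l w) (x0 : Eu d)
    {x y : ℕ → ℕ → Eu d} (h : ∀ n, IsGridEuler f g a z l n (x n) (y n)) (hx0 : ∀ n, x n 0 = x0)
    (T : ℝ) (hT : 0 ≤ T) :
    ∃ (M B : ℝ) (Ω : ℕ → ℕ → ℕ → ℝ), (∀ n, EulerControl p T M B n (x n) (y n) (Ω n)) ∧
      ∀ η : ℝ, 0 < η → ∃ P : Finset ℝ, (∀ ρ ∈ P, 0 < ρ) ∧ CellBound p T η l w x y Ω P := by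
  have hp := hc.one_le
  have hp0 : 0 < p := by linarith
  obtain ⟨M, A, F, hM, hA, hF0, hMA⟩ := exists_apriori_bound hc hD x0 T hT
  set R := fun n => totalReg (x n) (y n) with hR
  set N := fun n i : ℕ => (cellIndex F ((i : ℝ) / n) : ℝ) with hN
  have hRm : ∀ n, Monotone (R n) := fun n => (h n).totalReg_mono
  have hNm : ∀ n, Monotone (N n) := fun n i j hij => by
    simp only [hN, Nat.cast_le]
    exact cellIndex_mono F (by gcongr)
  have hR0 : ∀ n, R n 0 = 0 := fun n => by simp [hR, totalReg, (h n).y_zero]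
  have hn0 : ∀ n j : ℕ, 0 ≤ (j : ℝ) / n := fun n j => by positivity
  set Ω := fun n i k : ℕ => ((2 * A) ^ p * w ((i : ℝ) / n) ((k : ℝ) / n) +
    (2 : ℝ) ^ p * (R n k - R n i) ^ p) + (2 * M) ^ p * (N n k - N n i) with hΩ
  have hΩc : ∀ n, IsControl (Ω n) := fun n =>
    (((hD.ctrl.grid n).const_mul (by positivity)).add
      (((IsControl.of_monotone (hRm n)).rpow hp).const_mul (by positivity))).add
      ((IsControl.of_monotone (hNm n)).const_mul (by positivity))
  have hR2 : ∀ n i k, i ≤ k → (2 * (R n k - R n i)) ^ p = (2 : ℝ) ^ p * (R n k - R n i) ^ p :=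
    fun n i k hik => Real.mul_rpow (by norm_num) (sub_nonneg.2 (hRm n hik))
  refine ⟨M, (2 * A) ^ p * w 0 T + 2 ^ p * (d * (2 * M)) ^ p + (2 * M) ^ p * F.card, Ω,
    fun n => ⟨hΩc n, fun j hj => ((hMA n _ _ (h n) (hx0 n)).1 j hj).1,
      fun j hj => ((hMA n _ _ (h n) (hx0 n)).1 j hj).2, fun i k hik hk => ?_, fun k hk => ?_⟩,
      fun η hη => ?_⟩
  · have hw0 := hD.ctrl.nonneg (hn0 n i) (show (i : ℝ) / n ≤ (k : ℝ) / n by gcongr)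
    have hRik := sub_nonneg.2 (hRm n hik)
    have hNik := sub_nonneg.2 (hNm n hik)
    by_cases hcell : SameCell F ((i : ℝ) / n) ((k : ℝ) / n)
    · have h1 := (hMA n _ _ (h n) (hx0 n)).2 i k hik hk hcell
      have h2 := (h n).norm_x_sub_le hik
      refine (h2.trans (add_le_add h1 le_rfl)).trans ((add_le_ctrl_rpow hp hA hw0 hRik).trans ?_)
      rw [hR2 n i k hik]
      exact Real.rpow_le_rpow (by positivity) (le_add_of_nonneg_right (by positivity))
        (by positivity)
    · have h1 := cellIndex_lt_of_not_sameCell hcell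
      have h2 : 1 ≤ N n k - N n i := by
        have : (cellIndex F ((i : ℝ) / n) : ℝ) + 1 ≤ cellIndex F ((k : ℝ) / n) := by
          exact_mod_cast h1
        simp only [hN]; linarith
      have h3 := ((hMA n _ _ (h n) (hx0 n)).1 k hk).1
      have h4 := ((hMA n _ _ (h n) (hx0 n)).1 i (le_trans (by gcongr) hk)).1
      calc ‖x n k - x n i‖ ≤ 2 * M := (norm_sub_le _ _).trans (by linarith)
        _ = ((2 * M) ^ p) ^ (1 / p) := by
          rw [← Real.rpow_mul (by positivity), mul_one_div_cancel hp0.ne', Real.rpow_one]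
        _ ≤ _ := by
          refine Real.rpow_le_rpow (by positivity) ?_ (by positivity)
          have : (2 * M) ^ p ≤ (2 * M) ^ p * (N n k - N n i) :=
            le_mul_of_one_le_right (by positivity) h2
          have : 0 ≤ (2 * A) ^ p * w ((i : ℝ) / n) ((k : ℝ) / n) +
            (2 : ℝ) ^ p * (R n k - R n i) ^ p := by positivity
          simp only [hΩ]
          linarith
  · have h3 := (hMA n _ _ (h n) (hx0 n)).1 k hk
    have hRk : R n k - R n 0 ≤ d * (2 * M) := by
      rw [hR0, sub_zero]
      simp only [hR, totalReg]
      calc ∑ i, (x n k i - y n k i) ≤ ∑ _i : Fin d, 2 * M := by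
            refine Finset.sum_le_sum fun i _ => ?_
            have e1 := abs_le.1 (Eu.abs_apply_le_norm (x n k) i)
            have e2 := abs_le.1 (Eu.abs_apply_le_norm (y n k) i)
            linarith
        _ = _ := by simp
    have hRk0 : 0 ≤ R n k - R n 0 := sub_nonneg.2 (hRm n (Nat.zero_le k))
    have hNk : N n k - N n 0 ≤ F.card := by
      have e1 : (cellIndex F ((k : ℝ) / n) : ℝ) ≤ F.card := by
        exact_mod_cast cellIndex_le_card F _
      have e2 : (0 : ℝ) ≤ N n 0 := by simp [hN]
      simp only [hN] at e1 e2 ⊢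
      linarith
    have hwk : w (((0 : ℕ) : ℝ) / n) ((k : ℝ) / n) ≤ w 0 T :=
      hD.ctrl.mono le_rfl (hn0 n 0) (by gcongr; omega) hk
    simp only [hΩ]
    gcongr
  · have hlim : Tendsto (fun ε : ℝ => (2 * A) ^ p * ε + 2 ^ p * (d * (ε + A * ε ^ (1 / p))) ^ p +
        A * ε ^ (1 / p) + ε) (nhdsWithin 0 (Ioi 0)) (nhds 0) := by
      have hct : Continuous (fun ε : ℝ => (2 * A) ^ p * ε +
          2 ^ p * (d * (ε + A * ε ^ (1 / p))) ^ p + A * ε ^ (1 / p) + ε) := by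
        have : Continuous fun ε : ℝ => ε ^ (1 / p) := Real.continuous_rpow_const (by positivity)
        have h2 : Continuous fun ε : ℝ => (d * (ε + A * ε ^ (1 / p))) ^ p :=
          (Real.continuous_rpow_const hp0.le).comp (by fun_prop)
        fun_prop
      have := hct.tendsto 0
      have h1p : (0 : ℝ) ^ (1 / p) = 0 := Real.zero_rpow (by positivity)
      simp only [h1p, mul_zero, add_zero, Real.zero_rpow hp0.ne'] at this
      exact this.mono_left nhdsWithin_le_nhds
    obtain ⟨ε, hεη, hε : 0 < ε⟩ := ((hlim.eventually_lt_const hη).and self_mem_nhdsWithin).exists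
    obtain ⟨P, hP0, hP⟩ := hD.cells T hε
    classical
    have e1 : 0 ≤ (2 * A) ^ p * ε := by positivity
    have e2 : 0 ≤ 2 ^ p * (d * (ε + A * ε ^ (1 / p))) ^ p := by positivity
    have e3 : 0 ≤ A * ε ^ (1 / p) := by positivity
    refine ⟨P ∪ F, fun ρ hρ => (Finset.mem_union.1 hρ).elim (hP0 ρ) (hF0 ρ),
      fun r r' h0 h1 h2 h3 => ?_, fun n i k hik hk hcell => ?_⟩
    · obtain ⟨h4, h5⟩ := hP r r' h0 h1 h2 (h3.subset Finset.subset_union_left)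
      exact ⟨by linarith, by linarith⟩
    · have hcP := hcell.subset (F' := P) Finset.subset_union_left
      have hcF := hcell.subset (F' := F) Finset.subset_union_right
      have hik' : (i : ℝ) / n ≤ (k : ℝ) / n := by gcongr
      have hw := (hP _ _ (hn0 n i) hik' (hik'.trans hk) hcP).1
      have hw0 := hD.ctrl.nonneg (hn0 n i) hik'
      have hy : ∀ j, i ≤ j → j ≤ k → ‖y n j - y n i‖ ≤ A * ε ^ (1 / p) := fun j h1 h2 => by
        have hj : (j : ℝ) / n ≤ (k : ℝ) / n := by gcongr
        have hij : (i : ℝ) / n ≤ (j : ℝ) / n := by gcongr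
        have hj0 := hD.ctrl.nonneg (hn0 n i) hij
        refine ((hMA n _ _ (h n) (hx0 n)).2 i j h1 (hj.trans hk) (hcF.mono le_rfl hj)).trans ?_
        have := (hD.ctrl.mono (hn0 n i) le_rfl hij hj).trans hw
        gcongr
      have hl : ∀ j : ℕ, i ≤ j → j ≤ k → ‖l ((j : ℝ) / n) - l ((i : ℝ) / n)‖ ≤ ε :=
        fun j h1 h2 => (hP _ _ (hn0 n i) (by gcongr) (hik'.trans hk)
          (hcP.mono le_rfl (by gcongr))).2
      have hReg := (h n).totalReg_sub_le hik hl hy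
      have hReg0 := sub_nonneg.2 (hRm n hik)
      have hNN : N n k - N n i = 0 := by
        have : cellIndex F ((k : ℝ) / n) = cellIndex F ((i : ℝ) / n) := by
          unfold cellIndex
          congr 1
          refine Finset.filter_congr fun ρ hρ => ⟨fun h1 => ?_, fun h1 => h1.trans hik'⟩
          exact le_of_not_gt fun h2 => hcF ρ hρ ⟨h2, h1⟩
        simp [hN, this]
      have hΩη : Ω n i k ≤ (2 * A) ^ p * ε + 2 ^ p * (d * (ε + A * ε ^ (1 / p))) ^ p := by
        simp only [hΩ, hNN, mul_zero, add_zero]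
        gcongr
      exact ⟨by linarith, by linarith [hy k hik le_rfl]⟩

end UniformControl

/-- The index of the grid of step `1 / n` reached at the rescaled time `t`. -/
def gridIdx (n : ℕ) (lam : ℝ → ℝ) (t : ℝ) : ℕ := ⌊(n : ℝ) * lam t⌋₊

/-- A time change `ε`-close to the identity which aligns the points of `F` with the grid of
step `1 / n`. -/
structure IsTimeGrid (F : Finset ℝ) (ε : ℝ) (n : ℕ) (lam : ℝ → ℝ) : Prop where
  pos : 0 < n
  strictMono : StrictMono lam
  surjective : Surjective lam
  zero : lam 0 = 0
  close : ∀ t, |lam t - t| ≤ ε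
  align : ∀ r ∈ F, lam r = (⌈(n : ℝ) * r⌉₊ : ℝ) / n

namespace IsTimeGrid

variable {F : Finset ℝ} {ε : ℝ} {n : ℕ} {lam : ℝ → ℝ}

lemma nonneg (h : IsTimeGrid F ε n lam) {t : ℝ} (ht : 0 ≤ t) : 0 ≤ lam t :=
  h.zero ▸ h.strictMono.monotone ht

lemma gridIdx_zero (h : IsTimeGrid F ε n lam) : gridIdx n lam 0 = 0 := by
  simp [gridIdx, h.zero]

lemma gridIdx_mono (h : IsTimeGrid F ε n lam) : Monotone (gridIdx n lam) := fun _ _ hst =>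
  Nat.floor_mono (by gcongr; exact h.strictMono.monotone hst)

lemma exists_gridIdx_eq (h : IsTimeGrid F ε n lam) {s t : ℝ} (hs : 0 ≤ s) (hst : s ≤ t) {j : ℕ}
    (h1 : gridIdx n lam s ≤ j) (h2 : j ≤ gridIdx n lam t) :
    ∃ u, s ≤ u ∧ u ≤ t ∧ gridIdx n lam u = j := by
  have hn : (0 : ℝ) < n := by exact_mod_cast h.pos
  rcases h1.eq_or_lt with h1 | h1
  · exact ⟨s, le_rfl, hst, h1⟩
  · obtain ⟨u, hu⟩ := h.surjective ((j : ℝ) / n)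
    have hnu : (n : ℝ) * lam u = j := by rw [hu]; field_simp
    refine ⟨u, ?_, ?_, by simp [gridIdx, hnu]⟩
    · refine (h.strictMono.lt_iff_lt.1 ?_).le
      rw [hu, lt_div_iff₀ hn, mul_comm]
      exact (Nat.floor_lt (mul_nonneg hn.le (h.nonneg hs))).1 h1
    · refine h.strictMono.le_iff_le.1 ?_
      rw [hu, div_le_iff₀ hn, mul_comm]
      exact (Nat.le_floor_iff (mul_nonneg hn.le (h.nonneg (hs.trans hst)))).1 h2

lemma gridIdx_div_le (h : IsTimeGrid F ε n lam) {t : ℝ} (ht : 0 ≤ t) :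
    (gridIdx n lam t : ℝ) / n ≤ t + ε := by
  have hn : (0 : ℝ) < n := by exact_mod_cast h.pos
  rw [div_le_iff₀ hn, mul_comm]
  refine (Nat.floor_le (mul_nonneg hn.le (h.nonneg ht))).trans ?_
  gcongr
  linarith [le_abs_self (lam t - t), h.close t]

lemma le_gridIdx_div_iff (h : IsTimeGrid F ε n lam) {r t : ℝ} (hr : r ∈ F) (ht : 0 ≤ t) :
    r ≤ (gridIdx n lam t : ℝ) / n ↔ r ≤ t := by
  have hn : (0 : ℝ) < n := by exact_mod_cast h.pos
  rw [le_div_iff₀ hn, mul_comm, ← Nat.ceil_le, gridIdx,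
    Nat.le_floor_iff (mul_nonneg hn.le (h.nonneg ht)), ← div_le_iff₀' hn, ← h.align r hr, h.strictMono.le_iff_le]

end IsTimeGrid

lemma abs_bump_sub_le {η : ℝ} (hη : 0 < η) (r s t : ℝ) :
    |max 0 (1 - |t - r| / η) - max 0 (1 - |s - r| / η)| ≤ |t - s| / η := by
  rw [max_comm 0, max_comm 0]
  refine (abs_max_sub_max_le_abs _ _ _).trans ?_
  have : 1 - |t - r| / η - (1 - |s - r| / η) = (|s - r| - |t - r|) / η := by ring
  rw [this, abs_div, abs_of_pos hη]
  refine div_le_div_of_nonneg_right ((abs_abs_sub_abs_le _ _).trans (le_of_eq ?_)) hη.le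
  rw [abs_sub_comm]
  congr 1
  ring

lemma exists_isTimeGrid (F : Finset ℝ) (hF : ∀ ρ ∈ F, 0 < ρ) {ε : ℝ} (hε : 0 < ε) :
    ∀ᶠ n : ℕ in atTop, ∃ lam, IsTimeGrid F ε n lam := by
  obtain ⟨η, hsep, hη : 0 < η⟩ : ∃ η, (∀ r ∈ insert 0 F, ∀ r' ∈ insert 0 F, r ≠ r' →
      η ≤ |r - r'|) ∧ η ∈ Ioi (0 : ℝ) := by
    refine Eventually.exists (f := nhdsWithin (0 : ℝ) (Ioi 0)) (Eventually.and ?_ self_mem_nhdsWithin)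
    refine (Finset.eventually_all _).2 fun r _ => (Finset.eventually_all _).2 fun r' _ => ?_
    by_cases h : r = r'
    · simp [h]
    · filter_upwards [mem_nhdsWithin_of_mem_nhds (Iic_mem_nhds (abs_pos.2 (sub_ne_zero.2 h)))]
        with η hη _ using hη
  have hlim : Tendsto (fun n : ℕ => (F.card : ℝ) / n) atTop (nhds 0) :=
    tendsto_const_div_atTop_nhds_zero_nat _
  filter_upwards [hlim.eventually_lt_const hη, hlim.eventually_le_const hε, eventually_gt_atTop 0]
    with n h1 h2 hn0
  have hn : (0 : ℝ) < n := by exact_mod_cast hn0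
  set c : ℝ → ℝ := fun r => (⌈(n : ℝ) * r⌉₊ : ℝ) / n - r with hc
  have hc0 : ∀ r, 0 ≤ c r := fun r => by
    simp only [hc, sub_nonneg]
    rw [le_div_iff₀ hn, mul_comm]
    exact Nat.le_ceil _
  have hc1 : ∀ r ∈ F, c r ≤ 1 / n := fun r hr => by
    simp only [hc]
    rw [sub_le_iff_le_add, div_le_iff₀ hn, add_mul, one_div_mul_cancel hn.ne']
    have := (Nat.ceil_lt_add_one (mul_nonneg hn.le (hF r hr).le)).le
    linarith
  set lam : ℝ → ℝ := fun t => t + ∑ r ∈ F, c r * max 0 (1 - |t - r| / η) with hlam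
  have hclose : ∀ t, |lam t - t| ≤ ε := fun t => by
    refine le_trans ?_ h2
    simp only [hlam, add_sub_cancel_left]
    refine (Finset.abs_sum_le_sum_abs _ _).trans ?_
    rw [div_eq_mul_one_div, ← nsmul_eq_mul]
    refine Finset.sum_le_card_nsmul _ _ _ fun r hr => ?_
    rw [abs_of_nonneg (mul_nonneg (hc0 r) (le_max_left _ _))]
    have : max 0 (1 - |t - r| / η) ≤ 1 := max_le zero_le_one (by
      have : 0 ≤ |t - r| / η := by positivity
      linarith)
    calc c r * max 0 (1 - |t - r| / η) ≤ 1 / n * 1 := by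
          gcongr
          exact hc1 r hr
      _ = _ := mul_one _
  have hzero : ∀ t ∈ insert 0 F, ∀ r ∈ F, r ≠ t → max 0 (1 - |t - r| / η) = 0 := by
    intro t ht r hr hrt
    refine max_eq_left ?_
    have := hsep t ht r (Finset.mem_insert_of_mem hr) hrt.symm
    rw [sub_nonpos, le_div_iff₀ hη]
    linarith
  refine ⟨lam, hn0, fun s t hst => ?_, ?_, ?_, hclose, fun r hr => ?_⟩
  · have h3 : |∑ r ∈ F, c r * max 0 (1 - |t - r| / η) - ∑ r ∈ F, c r * max 0 (1 - |s - r| / η)|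
        < t - s := by
      rw [← Finset.sum_sub_distrib]
      refine (Finset.abs_sum_le_sum_abs _ _).trans_lt ?_
      calc ∑ r ∈ F, |c r * max 0 (1 - |t - r| / η) - c r * max 0 (1 - |s - r| / η)|
          ≤ F.card • (1 / n * ((t - s) / η)) := by
            refine Finset.sum_le_card_nsmul _ _ _ fun r hr => ?_
            rw [← mul_sub, abs_mul, abs_of_nonneg (hc0 r)]
            have := abs_bump_sub_le hη r s t
            rw [abs_of_pos (sub_pos.2 hst)] at this
            have := hc1 r hr
            have := hc0 r
            gcongr
        _ = (F.card / n / η) * (t - s) := by rw [nsmul_eq_mul]; ring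
        _ < 1 * (t - s) := by
            have := sub_pos.2 hst
            gcongr
            rwa [div_lt_one hη]
        _ = t - s := one_mul _
    have := (abs_lt.1 h3).1
    simp only [hlam]
    linarith
  · have hcont : Continuous lam := by
      simp only [hlam]
      fun_prop
    refine hcont.surjective ?_ ?_
    · refine tendsto_atTop_mono (f := fun t => t - ε) (fun t => ?_)
        (tendsto_atTop_add_const_right _ _ tendsto_id)
      linarith [(abs_le.1 (hclose t)).1]
    · refine tendsto_atBot_mono (fun t => (?_ : lam t ≤ t + ε))
        (tendsto_atBot_add_const_right _ _ tendsto_id)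
      linarith [(abs_le.1 (hclose t)).2]
  · simp only [hlam, zero_add]
    refine Finset.sum_eq_zero fun r hr => ?_
    rw [hzero 0 (Finset.mem_insert_self _ _) r hr (hF r hr).ne', mul_zero]
  · simp only [hlam]
    rw [Finset.sum_eq_single_of_mem r hr fun r' hr' hne => by
      rw [hzero r (Finset.mem_insert_of_mem hr) r' hr' hne, mul_zero]]
    simp [hc]

lemma exists_isTimeGrid_seq (F : ℕ → Finset ℝ) (hF : ∀ m, ∀ ρ ∈ F m, 0 < ρ) :
    ∃ (n : ℕ → ℕ) (lam : ℕ → ℝ → ℝ), StrictMono n ∧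
      ∀ m, IsTimeGrid (F m) (1 / ((m : ℝ) + 1)) (n m) (lam m) := by
  obtain ⟨n, hn, h⟩ := extraction_forall_of_eventually fun m : ℕ =>
    exists_isTimeGrid (F m) (hF m) (ε := 1 / ((m : ℝ) + 1)) (by positivity)
  choose lam hlam using h
  exact ⟨n, lam, hn, hlam⟩

/-- A sequence of functions which is locally bounded and asymptotically equi-oscillating on the
cells of finite partitions has a locally uniformly convergent subsequence. -/
theorem exists_subseq_locally_uniform {V : Type*} [NormedAddCommGroup V] [ProperSpace V]
    (u : ℕ → ℝ → V)
    (hb : ∀ T : ℕ, ∃ M : ℝ, ∀ (m : ℕ) (t : ℝ), 0 ≤ t → t ≤ T → ‖u m t‖ ≤ M)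
    (ho : ∀ (T : ℕ) (η : ℝ), 0 < η → ∃ P : Finset ℝ, ∀ᶠ m in atTop, ∀ s t : ℝ, 0 ≤ s → s ≤ t →
      t ≤ T → SameCell P s t → ‖u m t - u m s‖ ≤ η) :
    ∃ (ψ : ℕ → ℕ) (v : ℝ → V), StrictMono ψ ∧
      ∀ (T : ℕ) (η : ℝ), 0 < η → ∀ᶠ j in atTop, ∀ t : ℝ, 0 ≤ t → t ≤ T → ‖u (ψ j) t - v t‖ ≤ η := by
  have hle : (hyperfilter ℕ : Filter ℕ) ≤ atTop := by
    rw [← Nat.cofinite_eq_atTop]; exact hyperfilter_le_cofinite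
  have hpt : ∀ t, ∃ v, 0 ≤ t → Tendsto (fun m => u m t) (hyperfilter ℕ : Filter ℕ) (nhds v) := by
    intro t
    by_cases ht : 0 ≤ t
    · obtain ⟨M, hM⟩ := hb ⌈t⌉₊
      obtain ⟨v, -, hv⟩ := (isCompact_closedBall (0 : V) M).ultrafilter_le_nhds
        ((hyperfilter ℕ).map fun m => u m t) (by
          refine le_principal_iff.2 (mem_map.2 (univ_mem' fun m => ?_))
          simpa using hM m t ht (Nat.le_ceil t))
      exact ⟨v, fun _ => hv⟩
    · exact ⟨0, fun h => absurd h ht⟩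
  choose v hv using hpt
  have key : ∀ (T : ℕ) (η : ℝ), 0 < η → ∀ᶠ m in (hyperfilter ℕ : Filter ℕ),
      ∀ t : ℝ, 0 ≤ t → t ≤ T → ‖u m t - v t‖ ≤ η := by
    intro T η hη
    obtain ⟨P, hP⟩ := ho T (η / 3) (by positivity)
    have hP' := hle hP
    have hfin : ∀ᶠ m in (hyperfilter ℕ : Filter ℕ), ∀ s ∈ insert 0 P, 0 ≤ s →
        ‖u m s - v s‖ ≤ η / 3 := by
      refine (Finset.eventually_all _).2 fun s _ => ?_
      by_cases h0 : 0 ≤ s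
      · have := (tendsto_iff_norm_sub_tendsto_zero.1 (hv s h0)).eventually_le_const
          (show 0 < η / 3 by positivity)
        filter_upwards [this] with m hm _ using hm
      · exact Eventually.of_forall fun m h => absurd h h0
    have hosc : ∀ s t : ℝ, 0 ≤ s → s ≤ t → t ≤ T → SameCell P s t → ‖v t - v s‖ ≤ η / 3 := by
      intro s t h0 h1 h2 h3
      refine le_of_tendsto (((hv t (h0.trans h1)).sub (hv s h0)).norm) ?_
      filter_upwards [hP'] with m hm using hm s t h0 h1 h2 h3
    filter_upwards [hP', hfin] with m h1 h2 t h3 h4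
    obtain ⟨s, hs, hs0, hst, hc⟩ := exists_cell_start P h3
    have e1 := h1 s t hs0 hst h4 hc
    have e2 := h2 s hs hs0
    have e3 := hosc s t hs0 hst h4 hc
    calc ‖u m t - v t‖ = ‖(u m t - u m s) + (u m s - v s) - (v t - v s)‖ := by congr 1; abel
      _ ≤ ‖u m t - u m s‖ + ‖u m s - v s‖ + ‖v t - v s‖ :=
        (norm_sub_le _ _).trans (by gcongr; exact norm_add_le _ _)
      _ ≤ η := by linarith
  obtain ⟨ψ, hψ, h⟩ := extraction_forall_of_frequently fun N : ℕ =>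
    ((key N (1 / ((N : ℝ) + 1)) (by positivity)).frequently).filter_mono hle
  refine ⟨ψ, v, hψ, fun T η hη => ?_⟩
  have := (tendsto_one_div_add_atTop_nhds_zero_nat (𝕜 := ℝ)).eventually_le_const hη
  filter_upwards [this, eventually_ge_atTop T] with j h1 h2 t h3 h4
  exact (h j t h3 (h4.trans (by exact_mod_cast h2))).trans h1

section EulerLimit

variable {d : ℕ} {p α L Cα : ℝ} {f : Eu d → Eu d} {g : Eu d → (Eu d →L[ℝ] Eu d)}
  {a : ℝ → ℝ} {z l : ℝ → Eu d} {w : ℝ → ℝ → ℝ}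

/-- Along the grids of step `1 / n m`, the Euler recursions `X m`, `Y m`, read through the index
maps `σ m`, converge locally uniformly to `x`, `y`, with uniform controls. -/
structure EulerLimit {d : ℕ} (p : ℝ) (f : Eu d → Eu d) (g : Eu d → (Eu d →L[ℝ] Eu d))
    (a : ℝ → ℝ) (z l : ℝ → Eu d) (w : ℝ → ℝ → ℝ) (x0 : Eu d) (n : ℕ → ℕ)
    (X Y : ℕ → ℕ → Eu d) (σ : ℕ → ℝ → ℕ) (x y : ℝ → Eu d) : Prop where
  euler : ∀ m, IsGridEuler f g a z l (n m) (X m) (Y m)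
  x_start : ∀ m, X m 0 = x0
  idx_zero : ∀ m, σ m 0 = 0
  idx_mono : ∀ m, Monotone (σ m)
  idx_surj : ∀ (m : ℕ) {s t : ℝ}, 0 ≤ s → s ≤ t → ∀ {j : ℕ}, σ m s ≤ j → j ≤ σ m t →
    ∃ u, s ≤ u ∧ u ≤ t ∧ σ m u = j
  idx_le : ∀ (m : ℕ) {t : ℝ}, 0 ≤ t → (σ m t : ℝ) / n m ≤ t + 1
  bounds : ∀ T : ℕ, ∃ (M B : ℝ) (Ω : ℕ → ℕ → ℕ → ℝ),
    (∀ m, EulerControl p T M B (n m) (X m) (Y m) (Ω m)) ∧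
    ∀ η : ℝ, 0 < η → ∃ P : Finset ℝ, (∀ ρ ∈ P, 0 < ρ) ∧
      (∀ r r' : ℝ, 0 ≤ r → r ≤ r' → r ≤ T → SameCell P r r' → w r r' ≤ η ∧ ‖l r' - l r‖ ≤ η) ∧
      ∀ᶠ m in atTop,
        (∀ i k : ℕ, i ≤ k → (k : ℝ) / n m ≤ T → SameCell P ((i : ℝ) / n m) ((k : ℝ) / n m) →
          Ω m i k ≤ η ∧ ‖Y m k - Y m i‖ ≤ η) ∧
        ∀ r ∈ P, ∀ t : ℝ, 0 ≤ t → (r ≤ (σ m t : ℝ) / n m ↔ r ≤ t)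
  lim : ∀ (T : ℕ) (η : ℝ), 0 < η → ∀ᶠ m in atTop, ∀ t : ℝ, 0 ≤ t → t ≤ T →
    ‖X m (σ m t) - x t‖ ≤ η ∧ ‖Y m (σ m t) - y t‖ ≤ η

lemma sameCell_of_le_iff {P : Finset ℝ} {s t s' t' : ℝ} (h : SameCell P s t)
    (hs : ∀ r ∈ P, r ≤ s' ↔ r ≤ s) (ht : ∀ r ∈ P, r ≤ t' ↔ r ≤ t) : SameCell P s' t' := by
  intro r hr hst
  refine h r hr ⟨?_, (ht r hr).1 hst.2⟩
  by_contra h1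
  exact absurd ((hs r hr).2 (not_lt.1 h1)) (not_le.2 hst.1)

theorem exists_eulerLimit (hc : IsCoeff p α L Cα f g) (hD : IsDriver p a z l w) (x0 : Eu d)
    {X Y : ℕ → ℕ → Eu d} (h : ∀ n, IsGridEuler f g a z l n (X n) (Y n))
    (hx0 : ∀ n, X n 0 = x0) :
    ∃ (n : ℕ → ℕ) (lam : ℕ → ℝ → ℝ) (x y : ℝ → Eu d), StrictMono n ∧
      (∀ m, StrictMono (lam m)) ∧ (∀ m, Surjective (lam m)) ∧ (∀ m, lam m 0 = 0) ∧
      (∀ m t, |lam m t - t| ≤ 1 / ((m : ℝ) + 1)) ∧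
      EulerLimit p f g a z l w x0 n (fun m => X (n m)) (fun m => Y (n m))
        (fun m => gridIdx (n m) (lam m)) x y := by
  have hp0 : 0 < p := by linarith [hc.one_le]
  choose M B Ω hΩ P hP0 hP using fun T : ℕ =>
    exists_eulerControl hc hD x0 h hx0 (T : ℝ) (Nat.cast_nonneg T)
  have hq : ∀ q : ℕ, 0 < 1 / ((q : ℝ) + 1) := fun q => by positivity
  classical
  set F : ℕ → Finset ℝ := fun m => (Finset.range (m + 1)).biUnion fun T =>
    (Finset.range (m + 1)).biUnion fun q => P T _ (hq q) with hF
  have hFsub : ∀ T q m : ℕ, T ≤ m → q ≤ m → P T _ (hq q) ⊆ F m := by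
    intro T q m hT hqm r hr
    simp only [hF, Finset.mem_biUnion, Finset.mem_range]
    exact ⟨T, by omega, q, by omega, hr⟩
  obtain ⟨n, lam, hn, hlam⟩ := exists_isTimeGrid_seq F fun m ρ hρ => by
    simp only [hF, Finset.mem_biUnion] at hρ
    obtain ⟨T, -, q, -, hr⟩ := hρ
    exact hP0 T _ (hq q) ρ hr
  set σ : ℕ → ℝ → ℕ := fun m => gridIdx (n m) (lam m) with hσ
  have hτ : ∀ (m : ℕ) {t : ℝ}, 0 ≤ t → (σ m t : ℝ) / n m ≤ t + 1 := fun m t ht => by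
    refine ((hlam m).gridIdx_div_le ht).trans ?_
    gcongr
    rw [div_le_one (by positivity)]
    linarith [(Nat.cast_nonneg m : (0 : ℝ) ≤ m)]
  have hcell : ∀ (T : ℕ) (η : ℝ), 0 < η → ∃ Q : Finset ℝ, (∀ ρ ∈ Q, 0 < ρ) ∧
      CellBound p T η l w X Y (Ω T) Q ∧
      ∀ᶠ m in atTop, ∀ r ∈ Q, ∀ t, 0 ≤ t → (r ≤ (σ m t : ℝ) / n m ↔ r ≤ t) := by
    intro T η hη
    obtain ⟨q, hqη⟩ := exists_nat_one_div_lt hη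
    refine ⟨P T _ (hq q), hP0 T _ (hq q), ⟨fun r r' h0 h1 h2 h3 => ?_, fun k i j h1 h2 h3 => ?_⟩, ?_⟩
    · obtain ⟨e1, e2⟩ := (hP T _ (hq q)).driver r r' h0 h1 h2 h3
      exact ⟨e1.trans hqη.le, e2.trans hqη.le⟩
    · obtain ⟨e1, e2⟩ := (hP T _ (hq q)).euler k i j h1 h2 h3
      exact ⟨e1.trans hqη.le, e2.trans hqη.le⟩
    · filter_upwards [eventually_ge_atTop (max T q)] with m hm r hr t ht
      exact (hlam m).le_gridIdx_div_iff
        (hFsub T q m ((le_max_left _ _).trans hm) ((le_max_right _ _).trans hm) hr) ht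
  obtain ⟨ψ, v, hψ, hv⟩ := exists_subseq_locally_uniform
    (fun m t => (X (n m) (σ m t), Y (n m) (σ m t)))
    (fun T => ⟨M (T + 1), fun m t h0 h1 => by
      have e : (σ m t : ℝ) / n m ≤ ((T + 1 : ℕ) : ℝ) := (hτ m h0).trans (by push_cast; linarith)
      exact norm_prod_le_iff.2 ⟨(hΩ (T + 1) (n m)).norm_x _ e, (hΩ (T + 1) (n m)).norm_y _ e⟩⟩)
    (fun T η hη => by
      obtain ⟨Q, -, hQ, hQm⟩ := hcell (T + 1) (min η (η ^ p)) (by positivity)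
      refine ⟨Q, ?_⟩
      filter_upwards [hQm] with m hm s t h0 h1 h2 h3
      have e : (σ m t : ℝ) / n m ≤ ((T + 1 : ℕ) : ℝ) :=
        (hτ m (h0.trans h1)).trans (by push_cast; linarith)
      have hst := (hlam m).gridIdx_mono h1
      obtain ⟨e1, e2⟩ := hQ.euler (n m) _ _ hst e (sameCell_of_le_iff h3
        (fun r hr => hm r hr s h0) fun r hr => hm r hr t (h0.trans h1))
      rw [Prod.mk_sub_mk]
      refine norm_prod_le_iff.2 ⟨?_, e2.trans (min_le_left _ _)⟩
      calc _ ≤ Ω (T + 1) (n m) (σ m s) (σ m t) ^ (1 / p) :=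
            (hΩ (T + 1) (n m)).norm_x_sub _ _ hst e
        _ ≤ (η ^ p) ^ (1 / p) := Real.rpow_le_rpow ((hΩ (T + 1) (n m)).ctrl.nonneg hst)
            (e1.trans (min_le_right _ _)) (by positivity)
        _ = η := by rw [← Real.rpow_mul hη.le, mul_one_div_cancel hp0.ne', Real.rpow_one])
  refine ⟨n ∘ ψ, lam ∘ ψ, fun t => (v t).1, fun t => (v t).2, hn.comp hψ,
    fun m => (hlam _).strictMono, fun m => (hlam _).surjective, fun m => (hlam _).zero,
    fun m t => ((hlam _).close t).trans ?_, ?_⟩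
  · have : (m : ℝ) ≤ ψ m := by exact_mod_cast hψ.id_le m
    gcongr
  · refine ⟨fun m => h _, fun m => hx0 _, fun m => (hlam _).gridIdx_zero,
      fun m => (hlam _).gridIdx_mono, fun m _ _ h0 h1 _ h2 h3 =>
        (hlam _).exists_gridIdx_eq h0 h1 h2 h3, fun m _ => hτ _, fun T => ?_, fun T η hη => ?_⟩
    · refine ⟨M T, B T, fun m => Ω T (n (ψ m)), fun m => hΩ T _, fun η hη => ?_⟩
      obtain ⟨Q, h1, h2, h3⟩ := hcell T η hη
      refine ⟨Q, h1, h2.driver, ?_⟩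
      filter_upwards [hψ.tendsto_atTop.eventually h3] with m hm using
        ⟨fun i k => h2.euler _ i k, hm⟩
    · filter_upwards [hv T η hη] with m hm t h0 h1
      exact norm_prod_le_iff.1 (hm t h0 h1)

end EulerLimit

section LimitProperties

lemma exists_sameCell_right (P : Finset ℝ) (t : ℝ) : ∃ u, t < u ∧ SameCell P t u := by
  have h : ∀ᶠ u in nhdsWithin t (Ioi t), ∀ r ∈ P, ¬ (t < r ∧ r ≤ u) := by
    rw [Filter.eventually_all_finset]
    intro r _
    by_cases hr : t < r
    · filter_upwards [Ioo_mem_nhdsGT hr] with u hu h1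
      exact absurd h1.2 (not_le.2 hu.2)
    · exact Eventually.of_forall fun u h1 => hr h1.1
  obtain ⟨u, hu, hut⟩ := (h.and self_mem_nhdsWithin).exists
  exact ⟨u, hut, hu⟩

variable {d : ℕ} {p : ℝ} {f : Eu d → Eu d} {g : Eu d → (Eu d →L[ℝ] Eu d)}
  {a : ℝ → ℝ} {z l : ℝ → Eu d} {w : ℝ → ℝ → ℝ} {x0 : Eu d} {n : ℕ → ℕ}
  {X Y : ℕ → ℕ → Eu d} {σ : ℕ → ℝ → ℕ} {x y : ℝ → Eu d}

namespace EulerLimit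

variable (hE : EulerLimit p f g a z l w x0 n X Y σ x y)
include hE

lemma cells (hp : 0 < p) (T : ℕ) {η : ℝ} (hη : 0 < η) : ∃ P : Finset ℝ,
    (∀ r r' : ℝ, 0 ≤ r → r ≤ r' → r' ≤ T → SameCell P r r' →
      ‖l r' - l r‖ ≤ η ∧ ‖x r' - x r‖ ≤ η ∧ ‖y r' - y r‖ ≤ η) := by
  obtain ⟨M, B, Ω, hΩ, hP⟩ := hE.bounds (T + 1)
  obtain ⟨P, hP0, hPd, hPe⟩ := hP (min η (η ^ p)) (by positivity)
  refine ⟨P, fun r r' h0 h1 h2 h3 => ?_⟩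
  have hT : ∀ (m : ℕ) {t : ℝ}, 0 ≤ t → t ≤ T → (σ m t : ℝ) / n m ≤ ((T + 1 : ℕ) : ℝ) :=
    fun m t h0 h1 => (hE.idx_le m h0).trans (by push_cast; linarith)
  have key : ∀ ε : ℝ, 0 < ε → ‖x r' - x r‖ ≤ η + ε + ε ∧ ‖y r' - y r‖ ≤ η + ε + ε := by
    intro ε hε
    obtain ⟨m, ⟨h4, h5⟩, h6⟩ := (hPe.and (hE.lim T ε hε)).exists
    obtain ⟨e1, e2⟩ := h6 r h0 (h1.trans h2)
    obtain ⟨e3, e4⟩ := h6 r' (h0.trans h1) h2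
    have hs := hE.idx_mono m h1
    obtain ⟨e5, e6⟩ := h4 _ _ hs (hT m (h0.trans h1) h2) (sameCell_of_le_iff h3
      (fun ρ hρ => h5 ρ hρ r h0) fun ρ hρ => h5 ρ hρ r' (h0.trans h1))
    have e7 : ‖X m (σ m r') - X m (σ m r)‖ ≤ η :=
      calc _ ≤ Ω m (σ m r) (σ m r') ^ (1 / p) :=
            (hΩ m).norm_x_sub _ _ hs (hT m (h0.trans h1) h2)
        _ ≤ (η ^ p) ^ (1 / p) := Real.rpow_le_rpow ((hΩ m).ctrl.nonneg hs)
            (e5.trans (min_le_right _ _)) (by positivity)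
        _ = η := by rw [← Real.rpow_mul hη.le, mul_one_div_cancel hp.ne', Real.rpow_one]
    have tri : ∀ u v u' v' : Eu d, ‖u' - u‖ ≤ η → ‖u - v‖ ≤ ε → ‖u' - v'‖ ≤ ε →
        ‖v' - v‖ ≤ η + ε + ε := fun u v u' v' h1 h2 h3 => by
      have : v' - v = (u' - u) + (u - v) - (u' - v') := by abel
      rw [this]
      exact (norm_sub_le _ _).trans (add_le_add ((norm_add_le _ _).trans (add_le_add h1 h2)) h3)
    exact ⟨tri _ _ _ _ e7 e1 e3, tri _ _ _ _ (e6.trans (min_le_left _ _)) e2 e4⟩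
  refine ⟨((hPd r r' h0 h1 (by push_cast; linarith) h3).2).trans (min_le_left _ _), ?_, ?_⟩
  · refine le_of_forall_pos_le_add fun ε hε => ?_
    linarith [(key (ε / 2) (half_pos hε)).1]
  · refine le_of_forall_pos_le_add fun ε hε => ?_
    linarith [(key (ε / 2) (half_pos hε)).2]

lemma near (hp : 0 < p) (hD : IsDriver p a z l w) (T : ℕ) {η : ℝ} (hη : 0 < η) :
    ∀ᶠ m in atTop, ∀ t : ℝ, 0 ≤ t → t ≤ T → |a ((σ m t : ℝ) / n m) - a t| ≤ η ∧
      ‖z ((σ m t : ℝ) / n m) - z t‖ ≤ η ∧ ‖l ((σ m t : ℝ) / n m) - l t‖ ≤ η := by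
  obtain ⟨M, B, Ω, hΩ, hP⟩ := hE.bounds (T + 1)
  obtain ⟨P, hP0, hPd, hPe⟩ := hP (min η (η ^ p)) (by positivity)
  have key : ∀ r r' : ℝ, 0 ≤ r → r ≤ r' → r ≤ ((T + 1 : ℕ) : ℝ) → SameCell P r r' →
      |a r' - a r| ≤ η ∧ ‖z r' - z r‖ ≤ η ∧ ‖l r' - l r‖ ≤ η := by
    intro r r' h0 h1 h2 h3
    obtain ⟨e1, e2⟩ := hPd r r' h0 h1 h2 h3
    refine ⟨(hD.abs_a h0 h1).trans (e1.trans (min_le_left _ _)), ?_, e2.trans (min_le_left _ _)⟩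
    calc _ ≤ w r r' ^ (1 / p) := hD.norm_z h0 h1
      _ ≤ (η ^ p) ^ (1 / p) := Real.rpow_le_rpow (hD.ctrl.nonneg h0 h1)
          (e1.trans (min_le_right _ _)) (by positivity)
      _ = η := by rw [← Real.rpow_mul hη.le, mul_one_div_cancel hp.ne', Real.rpow_one]
  filter_upwards [hPe] with m hm t h0 h1
  have hτ0 : 0 ≤ (σ m t : ℝ) / n m := by positivity
  rcases le_total t ((σ m t : ℝ) / n m) with h2 | h2
  · exact key _ _ h0 h2 (by push_cast; linarith) fun ρ hρ hh =>
      absurd ((hm.2 ρ hρ t h0).1 hh.2) (not_le.2 hh.1)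
  · have h3 := key _ _ hτ0 h2 (by push_cast; linarith) fun ρ hρ hh =>
      absurd ((hm.2 ρ hρ t h0).2 hh.2) (not_le.2 hh.1)
    rw [abs_sub_comm, norm_sub_rev, norm_sub_rev (l t)] at h3
    exact h3

lemma tendsto_X {t : ℝ} (ht : 0 ≤ t) :
    Tendsto (fun m => X m (σ m t)) atTop (nhds (x t)) := by
  rw [Metric.tendsto_atTop']
  intro ε hε
  obtain ⟨N, hN⟩ := eventually_atTop.1 (hE.lim ⌈t⌉₊ (ε / 2) (half_pos hε))
  exact ⟨N, fun m hm => by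
    rw [dist_eq_norm]
    linarith [(hN m hm.le t ht (Nat.le_ceil t)).1]⟩

lemma tendsto_Y {t : ℝ} (ht : 0 ≤ t) :
    Tendsto (fun m => Y m (σ m t)) atTop (nhds (y t)) := by
  rw [Metric.tendsto_atTop']
  intro ε hε
  obtain ⟨N, hN⟩ := eventually_atTop.1 (hE.lim ⌈t⌉₊ (ε / 2) (half_pos hε))
  exact ⟨N, fun m hm => by
    rw [dist_eq_norm]
    linarith [(hN m hm.le t ht (Nat.le_ceil t)).2]⟩

lemma tendsto_drivers (hp : 0 < p) (hD : IsDriver p a z l w) {t : ℝ} (ht : 0 ≤ t) :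
    Tendsto (fun m => a ((σ m t : ℝ) / n m)) atTop (nhds (a t)) ∧
    Tendsto (fun m => z ((σ m t : ℝ) / n m)) atTop (nhds (z t)) ∧
    Tendsto (fun m => l ((σ m t : ℝ) / n m)) atTop (nhds (l t)) := by
  have h : ∀ ε : ℝ, 0 < ε → ∃ N, ∀ m > N, |a ((σ m t : ℝ) / n m) - a t| < ε ∧
      ‖z ((σ m t : ℝ) / n m) - z t‖ < ε ∧ ‖l ((σ m t : ℝ) / n m) - l t‖ < ε := fun ε hε => by
    obtain ⟨N, hN⟩ := eventually_atTop.1 (hE.near hp hD ⌈t⌉₊ (half_pos hε))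
    refine ⟨N, fun m hm => ?_⟩
    obtain ⟨h1, h2, h3⟩ := hN m hm.le t ht (Nat.le_ceil t)
    exact ⟨by linarith, by linarith, by linarith⟩
  simp only [Metric.tendsto_atTop']
  refine ⟨fun ε hε => ?_, fun ε hε => ?_, fun ε hε => ?_⟩ <;> obtain ⟨N, hN⟩ := h ε hε
  · exact ⟨N, fun m hm => by rw [Real.dist_eq]; exact (hN m hm).1⟩
  · exact ⟨N, fun m hm => by rw [dist_eq_norm]; exact (hN m hm).2.1⟩
  · exact ⟨N, fun m hm => by rw [dist_eq_norm]; exact (hN m hm).2.2⟩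

lemma x_zero : x 0 = x0 := by
  refine tendsto_nhds_unique (hE.tendsto_X le_rfl) ?_
  simp only [hE.idx_zero, hE.x_start]
  exact tendsto_const_nhds

lemma y_zero : y 0 = x0 := by
  refine tendsto_nhds_unique (hE.tendsto_Y le_rfl) ?_
  simp only [hE.idx_zero, fun m => (hE.euler m).y_zero, hE.x_start]
  exact tendsto_const_nhds

lemma hasFinVar (hp : 0 < p) (T : ℝ) : HasFinVar p x 0 T := by
  obtain ⟨M, B, Ω, hΩ, -⟩ := hE.bounds (⌈T⌉₊ + 1)
  refine ⟨B, fun v hv => ?_⟩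
  obtain ⟨N, u, hu, h0, hT, rfl⟩ := mem_varSums_iff.1 hv
  have hu0 : ∀ i, 0 ≤ u i := fun i => h0 ▸ hu (Nat.zero_le i)
  have hT1 : ∀ m, (σ m T : ℝ) / n m ≤ ((⌈T⌉₊ + 1 : ℕ) : ℝ) := fun m =>
    (hE.idx_le m (hT ▸ hu0 N)).trans (by push_cast; linarith [Nat.le_ceil T])
  refine le_of_tendsto (tendsto_finsetSum (Finset.range N) fun i _ =>
    (((hE.tendsto_X (hu0 (i + 1))).sub (hE.tendsto_X (hu0 i))).norm).rpow_const
      (Or.inr hp.le)) (Eventually.of_forall fun m => ?_)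
  have hmono : Monotone fun i => σ m (u i) := (hE.idx_mono m).comp hu
  calc _ ≤ ∑ i ∈ Finset.range N, Ω m (σ m (u i)) (σ m (u (i + 1))) := by
        refine Finset.sum_le_sum fun i hi => ?_
        have hle : (σ m (u (i + 1)) : ℝ) / n m ≤ ((⌈T⌉₊ + 1 : ℕ) : ℝ) := by
          refine le_trans ?_ (hT1 m)
          gcongr
          exact hT ▸ hmono (by simpa [Nat.succ_le_iff] using hi)
        have hi1 := hmono (Nat.le_succ i)
        calc _ ≤ (Ω m (σ m (u i)) (σ m (u (i + 1))) ^ (1 / p)) ^ p :=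
              Real.rpow_le_rpow (norm_nonneg _) ((hΩ m).norm_x_sub _ _ hi1 hle) hp.le
          _ = _ := by
              rw [← Real.rpow_mul ((hΩ m).ctrl.nonneg hi1), one_div_mul_cancel hp.ne',
                Real.rpow_one]
    _ ≤ Ω m (σ m (u 0)) (σ m (u N)) := (hΩ m).ctrl.sum_le hmono N
    _ ≤ B := by
        rw [h0, hT, hE.idx_zero]
        exact (hΩ m).total _ (hT1 m)

end EulerLimit

end LimitProperties

section LimitSkorokhod

variable {d : ℕ} {p : ℝ} {f : Eu d → Eu d} {g : Eu d → (Eu d →L[ℝ] Eu d)}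
  {a : ℝ → ℝ} {z l : ℝ → Eu d} {w : ℝ → ℝ → ℝ} {x0 : Eu d} {n : ℕ → ℕ}
  {X Y : ℕ → ℕ → Eu d} {σ : ℕ → ℝ → ℕ} {x y : ℝ → Eu d}

lemma Eu.tendsto_apply {ι : Type*} {F : Filter ι} {u : ι → Eu d} {v : Eu d}
    (h : Tendsto u F (nhds v)) (i : Fin d) : Tendsto (fun m => u m i) F (nhds (v i)) :=
  ((by fun_prop : Continuous fun v : Eu d => v i).tendsto v).comp h

lemma Eu.abs_apply_sub_le {u v : Eu d} {η : ℝ} (h : ‖u - v‖ ≤ η) (i : Fin d) :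
    |u i - v i| ≤ η :=
  (Eu.abs_apply_le_norm (u - v) i).trans h

namespace EulerLimit

variable (hE : EulerLimit p f g a z l w x0 n X Y σ x y)
include hE

lemma l_le (hp : 0 < p) (hD : IsDriver p a z l w) {t : ℝ} (ht : 0 ≤ t) (i : Fin d) :
    l t i ≤ x t i :=
  le_of_tendsto_of_tendsto' (Eu.tendsto_apply (hE.tendsto_drivers hp hD ht).2.2 i)
    (Eu.tendsto_apply (hE.tendsto_X ht) i) fun m => (hE.euler m).l_le _ i

lemma reg_mono {s t : ℝ} (hs : 0 ≤ s) (hst : s ≤ t) (i : Fin d) :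
    x s i - y s i ≤ x t i - y t i :=
  le_of_tendsto_of_tendsto'
    ((Eu.tendsto_apply (hE.tendsto_X hs) i).sub (Eu.tendsto_apply (hE.tendsto_Y hs) i))
    ((Eu.tendsto_apply (hE.tendsto_X (hs.trans hst)) i).sub
      (Eu.tendsto_apply (hE.tendsto_Y (hs.trans hst)) i))
    fun m => (hE.euler m).reg_mono i (hE.idx_mono m hst)

lemma reg_le (hp : 0 < p) (hD : IsDriver p a z l w) {s t D : ℝ} (hs : 0 ≤ s) (hst : s ≤ t)
    (i : Fin d) (hk : x s i - y s i ≤ D) (hl : ∀ u ∈ Icc s t, l u i - y u i ≤ D) :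
    x t i - y t i ≤ D := by
  refine le_of_forall_pos_le_add fun ε hε => ?_
  have hε4 : 0 < ε / 4 := by positivity
  have ht := Nat.le_ceil t
  obtain ⟨m, h1, h2⟩ := ((hE.near hp hD ⌈t⌉₊ hε4).and (hE.lim ⌈t⌉₊ _ hε4)).exists
  obtain ⟨e1, e2⟩ := h2 s hs (hst.trans ht)
  obtain ⟨e3, e4⟩ := h2 t (hs.trans hst) ht
  have e1 := abs_le.1 (Eu.abs_apply_sub_le e1 i)
  have e2 := abs_le.1 (Eu.abs_apply_sub_le e2 i)
  have e3 := abs_le.1 (Eu.abs_apply_sub_le e3 i)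
  have e4 := abs_le.1 (Eu.abs_apply_sub_le e4 i)
  have key : X m (σ m t) i - Y m (σ m t) i ≤ D + ε / 2 := by
    refine (hE.euler m).reg_le_of (hE.idx_mono m hst) (by linarith) fun j h3 h4 => ?_
    obtain ⟨u, hu1, hu2, rfl⟩ := hE.idx_surj m hs hst h3 h4
    have e5 := abs_le.1 (Eu.abs_apply_sub_le (h2 u (hs.trans hu1) (hu2.trans ht)).2 i)
    have e6 := abs_le.1 (Eu.abs_apply_sub_le (h1 u (hs.trans hu1) (hu2.trans ht)).2.2 i)
    linarith [hl u ⟨hu1, hu2⟩]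
  linarith

lemma reg_eq (hp : 0 < p) (hD : IsDriver p a z l w) {s t : ℝ} (hs : 0 ≤ s) (hst : s ≤ t)
    (i : Fin d) (hl : ∀ u ∈ Icc s t, l u i < x u i) : x s i - y s i = x t i - y t i := by
  set K : ℝ → ℝ := fun u => x u i - y u i with hK
  set S : Set ℝ := {v | v ∈ Icc s t ∧ K v = K s}
  have hsS : s ∈ S := ⟨⟨le_rfl, hst⟩, rfl⟩
  have hSb : BddAbove S := ⟨t, fun v hv => hv.1.2⟩
  set c := sSup S with hc
  have hsc : s ≤ c := le_csSup hSb hsS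
  have hct : c ≤ t := csSup_le ⟨s, hsS⟩ fun v hv => hv.1.2
  have hlt : ∀ u, s ≤ u → u < c → K u = K s := by
    intro u hu huc
    obtain ⟨v, hv, huv⟩ := exists_lt_of_lt_csSup ⟨s, hsS⟩ huc
    exact le_antisymm ((hE.reg_mono (hs.trans hu) huv.le i).trans_eq hv.2)
      (hE.reg_mono hs hu i)
  have hlK : ∀ u ∈ Icc s t, l u i - y u i < K u := fun u hu => by
    linarith [hl u hu, show K u = x u i - y u i from rfl]
  have hKc : K c = K s := by
    refine le_antisymm ?_ (hE.reg_mono hs hsc i)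
    have h1 : K c ≤ max (K s) (l c i - y c i) := by
      refine hE.reg_le hp hD hs hsc i (le_max_left _ _) fun u hu => ?_
      rcases hu.2.lt_or_eq with h | h
      · exact ((hlK u ⟨hu.1, hu.2.trans hct⟩).le.trans_eq (hlt u hu.1 h)).trans (le_max_left _ _)
      · rw [h]
        exact le_max_right _ _
    rcases le_max_iff.1 h1 with h | h
    · exact h
    · exact absurd h (not_le.2 (hlK c ⟨hsc, hct⟩))
  rcases hct.lt_or_eq with h | h
  · exfalso
    have hgap : 0 < (K c - (l c i - y c i)) / 2 := half_pos (sub_pos.2 (hlK c ⟨hsc, hct⟩))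
    obtain ⟨P, hP⟩ := hE.cells hp ⌈t⌉₊ hgap
    obtain ⟨u, hcu, hu⟩ := exists_sameCell_right P c
    have hc0 := hs.trans hsc
    have h1 : c < min u t := lt_min hcu h
    have h2 : K (min u t) ≤ K c := by
      refine hE.reg_le hp hD hc0 h1.le i le_rfl fun v hv => ?_
      obtain ⟨e1, -, e2⟩ := hP c v hc0 hv.1
        ((hv.2.trans (min_le_right _ _)).trans (Nat.le_ceil t))
        (hu.mono le_rfl (hv.2.trans (min_le_left _ _)))
      have e1 := abs_le.1 (Eu.abs_apply_sub_le e1 i)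
      have e2 := abs_le.1 (Eu.abs_apply_sub_le e2 i)
      linarith
    have h3 : min u t ∈ S := ⟨⟨hsc.trans h1.le, min_le_right _ _⟩,
      le_antisymm (h2.trans_eq hKc) (hE.reg_mono hs (hsc.trans h1.le) i)⟩
    exact absurd (le_csSup hSb h3) (not_le.2 h1)
  · rw [← h]
    exact hKc.symm

lemma isSP (hp : 0 < p) (hD : IsDriver p a z l w) {y' : ℝ → Eu d}
    (hy : ∀ t, 0 ≤ t → y' t = y t) : IsSP d y' l x (fun t => x t - y t) := by
  refine ⟨fun t ht => by rw [hy t ht]; exact (add_sub_cancel _ _).symm, fun t ht i => hE.l_le hp hD ht i, ?_,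
    fun i s hs t _ hst => hE.reg_mono hs hst i, fun i s t hs hst h => hE.reg_eq hp hD hs hst i h⟩
  change x 0 - y 0 = 0
  rw [hE.x_zero, hE.y_zero, sub_self]

end EulerLimit

end LimitSkorokhod

section LimitIntegral

variable {Z E : Type*} [NormedAddCommGroup Z] [NormedSpace ℝ Z] [NormedAddCommGroup E]
  [NormedSpace ℝ E]

lemma sum_Ico_monotone {M : Type*} [AddCommMonoid M] (F : ℕ → M) {v : ℕ → ℕ} (hv : Monotone v)
    (N : ℕ) : ∑ i ∈ Finset.range N, ∑ j ∈ Finset.Ico (v i) (v (i + 1)), F j =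
      ∑ j ∈ Finset.Ico (v 0) (v N), F j := by
  induction N with
  | zero => simp
  | succ N ih =>
    rw [Finset.sum_range_succ, ih,
      Finset.sum_Ico_consecutive _ (hv (Nat.zero_le N)) (hv (Nat.le_succ N))]

lemma exists_fine_partition {T δ : ℝ} (hT : 0 ≤ T) (hδ : 0 < δ) : ∃ (N : ℕ) (u : ℕ → ℝ),
    Monotone u ∧ u 0 = 0 ∧ u N = T ∧ ∀ i < N, u (i + 1) - u i ≤ δ := by
  obtain ⟨N, hN⟩ := exists_nat_gt (T / δ)
  have hN0 : (0 : ℝ) < N := (div_nonneg hT hδ.le).trans_lt hN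
  refine ⟨N, fun i => i * (T / N), fun i j hij => ?_, by simp, by field_simp, fun i _ => ?_⟩
  · have : (i : ℝ) ≤ j := by exact_mod_cast hij
    dsimp only
    gcongr
  · have : ((i + 1 : ℕ) : ℝ) * (T / N) - i * (T / N) = T / N := by push_cast; ring
    rw [this, div_le_iff₀ hN0]
    rw [div_lt_iff₀ hδ] at hN
    linarith

/-- Left-point sums along grids converge to a Riemann–Stieltjes integral, provided that
coefficient and driver converge pointwise and the compensated sums over the intervals of a fine
partition are small. -/
theorem exists_isRSInt_of_compSum [CompleteSpace E] {T : ℝ} (hT : 0 ≤ T)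
    {σ : ℕ → ℝ → ℕ} (hσ : ∀ m, Monotone (σ m)) (hσ0 : ∀ m, σ m 0 = 0)
    {H : ℕ → ℕ → Z →L[ℝ] E} {ζ : ℕ → ℕ → Z} {h : ℝ → Z →L[ℝ] E} {z : ℝ → Z}
    (hH : ∀ t, 0 ≤ t → t ≤ T → Tendsto (fun m => H m (σ m t)) atTop (nhds (h t)))
    (hζ : ∀ t, 0 ≤ t → t ≤ T → Tendsto (fun m => ζ m (σ m t)) atTop (nhds (z t)))
    (hsmall : ∀ ε : ℝ, 0 < ε → ∃ δ : ℝ, 0 < δ ∧ ∀ (N : ℕ) (u : ℕ → ℝ), Monotone u → u 0 = 0 →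
      u N = T → (∀ i < N, u (i + 1) - u i ≤ δ) → ∀ᶠ m in atTop,
      ∑ i ∈ Finset.range N, ‖compSum (H m) (ζ m) (σ m (u i)) (σ m (u (i + 1)))‖ ≤ ε) :
    ∃ I : E, Tendsto (fun m => ∑ j ∈ Finset.range (σ m T), H m j (ζ m (j + 1) - ζ m j)) atTop
      (nhds I) ∧ IsRSInt (fun (A : Z →L[ℝ] E) (v : Z) => A v) h z 0 T I := by
  set J : ℕ → E := fun m => ∑ j ∈ Finset.range (σ m T), H m j (ζ m (j + 1) - ζ m j) with hJ
  have key : ∀ ε : ℝ, 0 < ε → ∃ δ : ℝ, 0 < δ ∧ ∀ (N : ℕ) (u : ℕ → ℝ), Monotone u → u 0 = 0 →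
      u N = T → (∀ i < N, u (i + 1) - u i ≤ δ) → ∀ᶠ m in atTop,
      ‖(∑ i ∈ Finset.range N, h (u i) (z (u (i + 1)) - z (u i))) - J m‖ ≤ ε := by
    intro ε hε
    obtain ⟨δ, hδ, hu⟩ := hsmall (ε / 2) (half_pos hε)
    refine ⟨δ, hδ, fun N u hmono h0 hN hmesh => ?_⟩
    have hui : ∀ i ≤ N, 0 ≤ u i ∧ u i ≤ T := fun i hi =>
      ⟨h0 ▸ hmono (Nat.zero_le i), hN ▸ hmono hi⟩
    have hlim : Tendsto (fun m => ∑ i ∈ Finset.range N,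
        H m (σ m (u i)) (ζ m (σ m (u (i + 1))) - ζ m (σ m (u i)))) atTop
        (nhds (∑ i ∈ Finset.range N, h (u i) (z (u (i + 1)) - z (u i)))) := by
      refine tendsto_finsetSum _ fun i hi => ?_
      have hi := Finset.mem_range.1 hi
      obtain ⟨e1, e2⟩ := hui i hi.le
      obtain ⟨e3, e4⟩ := hui (i + 1) hi
      exact (isBoundedBilinearMap_apply.continuous.tendsto
        (h (u i), z (u (i + 1)) - z (u i))).comp
        ((hH _ e1 e2).prodMk_nhds ((hζ _ e3 e4).sub (hζ _ e1 e2)))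
    filter_upwards [hu N u hmono h0 hN hmesh,
      (Metric.tendsto_nhds.1 hlim) (ε / 2) (half_pos hε)] with m h1 h2
    rw [dist_eq_norm] at h2
    have hv : Monotone fun i => σ m (u i) := (hσ m).comp hmono
    have hdec : J m = (∑ i ∈ Finset.range N,
        H m (σ m (u i)) (ζ m (σ m (u (i + 1))) - ζ m (σ m (u i)))) +
        ∑ i ∈ Finset.range N, compSum (H m) (ζ m) (σ m (u i)) (σ m (u (i + 1))) := by
      have := sum_Ico_monotone (fun j => H m j (ζ m (j + 1) - ζ m j)) hv N
      rw [h0, hσ0, hN, ← Finset.range_eq_Ico] at this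
      rw [hJ, ← Finset.sum_add_distrib]
      dsimp only
      rw [← this]
      exact Finset.sum_congr rfl fun i _ => sum_Ico_eq_compSum _ _ (hv (Nat.le_succ i))
    have h3 := (norm_sum_le _ _).trans h1
    rw [norm_sub_rev, hdec, add_sub_right_comm]
    exact (norm_add_le _ _).trans (by linarith)
  have hcau : CauchySeq J := by
    rw [Metric.cauchySeq_iff']
    intro ε hε
    obtain ⟨δ, hδ, hu⟩ := key (ε / 3) (by positivity)
    obtain ⟨N, u, h1, h2, h3, h4⟩ := exists_fine_partition hT hδ
    obtain ⟨m₀, hm⟩ := eventually_atTop.1 (hu N u h1 h2 h3 h4)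
    refine ⟨m₀, fun m hmm => ?_⟩
    have e1 := hm m hmm
    have e2 := hm m₀ le_rfl
    rw [← dist_eq_norm] at e1 e2
    linarith [dist_triangle_left (J m) (J m₀)
      (∑ i ∈ Finset.range N, h (u i) (z (u (i + 1)) - z (u i)))]
  obtain ⟨I, hI⟩ := cauchySeq_tendsto_of_complete hcau
  refine ⟨I, hI, fun ε hε => ?_⟩
  obtain ⟨δ, hδ, hu⟩ := key (ε / 2) (half_pos hε)
  refine ⟨δ, hδ, fun N t ht h0 hN hmesh => ?_⟩
  obtain ⟨u, hmono, hu0, huN, hut⟩ := exists_monotone_seq ht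
  have h1 := hu N u hmono (hu0.trans h0) (huN.trans hN) fun i hi => by
    obtain ⟨e1, e2⟩ := hut ⟨i, hi⟩
    rw [e1, e2]
    exact hmesh _
  have h2 := le_of_tendsto ((tendsto_const_nhds.sub hI).norm) h1
  have h3 : ∑ i ∈ Finset.range N, h (u i) (z (u (i + 1)) - z (u i)) =
      ∑ i : Fin N, h (t i.castSucc) (z (t i.succ) - z (t i.castSucc)) := by
    rw [Finset.sum_range]
    exact Finset.sum_congr rfl fun i _ => by rw [(hut i).1, (hut i).2]
  rw [h3] at h2
  linarith

end LimitIntegral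

section SmallCompensatedSums

variable {d : ℕ} {p : ℝ} {f : Eu d → Eu d} {g : Eu d → (Eu d →L[ℝ] Eu d)}
  {a : ℝ → ℝ} {z l : ℝ → Eu d} {w : ℝ → ℝ → ℝ} {x0 : Eu d} {n : ℕ → ℕ}
  {X Y : ℕ → ℕ → Eu d} {σ : ℕ → ℝ → ℕ} {x y : ℝ → Eu d}
  {Z E : Type*} [NormedAddCommGroup Z] [NormedSpace ℝ Z] [NormedAddCommGroup E] [NormedSpace ℝ E]

/-- A compensated sum over an interval containing at most one partition point is controlled by
its values on blocks inside a cell, up to a contribution of the partition point. -/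
lemma norm_compSum_le_of_gap {P : Finset ℝ} {ν : ℕ} {s t δ K η : ℝ} {τ : ℝ → ℕ}
    (hτ : Monotone τ) (hsurj : ∀ {j : ℕ}, τ s ≤ j → j ≤ τ t → ∃ u, s ≤ u ∧ u ≤ t ∧ τ u = j)
    (hs : 0 ≤ s) (hst : s ≤ t) (hδ : t - s ≤ δ)
    (hgap : ∀ r ∈ P, ∀ r' ∈ P, r < r' → δ ≤ r' - r)
    (halign : ∀ r ∈ P, ∀ t : ℝ, 0 ≤ t → (r ≤ (τ t : ℝ) / ν ↔ r ≤ t))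
    {H : ℕ → Z →L[ℝ] E} {ζ : ℕ → Z} {C : ℕ → ℕ → ℝ} (hC : IsControl C)
    (hK : ∀ j, j ≤ τ t → ‖H j‖ ≤ K) (hη : 0 ≤ η)
    (hζ : ∀ r ∈ P, s < r → r ≤ t → ‖ζ (τ t) - ζ (τ r)‖ ≤ η)
    (hblock : ∀ b e, b ≤ e → e ≤ τ t →
      (∀ j, b ≤ j → j < e → SameCell P ((b : ℝ) / ν) ((j : ℝ) / ν)) →
      ‖compSum H ζ b e‖ ≤ C b e) :
    ‖compSum H ζ (τ s) (τ t)‖ ≤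
      C (τ s) (τ t) + 2 * K * η * (cellIndex P t - cellIndex P s) := by
  have hK0 : 0 ≤ K := (norm_nonneg _).trans (hK 0 (Nat.zero_le _))
  by_cases hcell : SameCell P s t
  · refine (hblock _ _ (hτ hst) le_rfl fun j h1 h2 => ?_).trans ?_
    · obtain ⟨u, hu1, hu2, rfl⟩ := hsurj h1 h2.le
      exact sameCell_of_le_iff (hcell.mono le_rfl hu2) (fun r hr => halign r hr s hs)
        fun r hr => halign r hr u (hs.trans hu1)
    · have : (cellIndex P s : ℝ) ≤ cellIndex P t := by exact_mod_cast cellIndex_mono P hst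
      have := mul_nonneg (mul_nonneg (mul_nonneg zero_le_two hK0) hη) (sub_nonneg.2 this)
      linarith
  · have hidx : (cellIndex P s : ℝ) + 1 ≤ cellIndex P t := by
      exact_mod_cast cellIndex_lt_of_not_sameCell hcell
    unfold SameCell at hcell
    push Not at hcell
    obtain ⟨r, hr, hsr, hrt⟩ := hcell
    have huniq : ∀ r' ∈ P, s < r' → r' ≤ t → r' = r := by
      intro r' hr' h1 h2
      rcases lt_trichotomy r r' with h | h | h
      · linarith [hgap r hr r' hr' h]
      · exact h.symm
      · linarith [hgap r' hr' r hr h]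
    have h1 := hτ hsr.le
    have h2 := hτ hrt
    have hr0 := hs.trans hsr.le
    have e1 : ‖compSum H ζ (τ s) (τ r)‖ ≤ C (τ s) (τ r) := by
      refine hblock _ _ h1 h2 fun j h3 h4 r' hr' h5 => ?_
      obtain ⟨u, hu1, hu2, rfl⟩ := hsurj h3 (h4.le.trans h2)
      have h6 := (halign r' hr' u (hs.trans hu1)).1 h5.2
      have h7 : s < r' := not_le.1 fun h => absurd ((halign r' hr' s hs).2 h) (not_le.2 h5.1)
      rw [huniq r' hr' h7 (h6.trans hu2)] at h6
      exact absurd (hτ h6) (not_le.2 h4)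
    have e2 : ‖compSum H ζ (τ r) (τ t)‖ ≤ C (τ r) (τ t) := by
      refine hblock _ _ h2 le_rfl fun j h3 h4 r' hr' h5 => ?_
      obtain ⟨u, hu1, hu2, rfl⟩ := hsurj (h1.trans h3) h4.le
      have h6 := (halign r' hr' u (hs.trans hu1)).1 h5.2
      have h7 : r < r' := not_le.1 fun h => absurd ((halign r' hr' r hr0).2 h) (not_le.2 h5.1)
      exact h7.ne' (huniq r' hr' (hsr.trans h7) (h6.trans hu2))
    have e3 : ‖(H (τ r) - H (τ s)) (ζ (τ t) - ζ (τ r))‖ ≤ 2 * K * η := by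
      refine (ContinuousLinearMap.le_opNorm _ _).trans ?_
      refine mul_le_mul ?_ (hζ r hr hsr hrt) (norm_nonneg _) (by positivity)
      refine (norm_sub_le _ _).trans ?_
      linarith [hK _ h2, hK _ (h1.trans h2)]
    have e4 := hC.superadd h1 h2
    have e5 : 2 * K * η * 1 ≤ 2 * K * η * (cellIndex P t - cellIndex P s) :=
      mul_le_mul_of_nonneg_left (by linarith) (by positivity)
    rw [compSum_split H ζ h1 h2]
    have := norm_add₃_le (a := compSum H ζ (τ s) (τ r)) (b := compSum H ζ (τ r) (τ t))
      (c := (H (τ r) - H (τ s)) (ζ (τ t) - ζ (τ r)))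
    linarith

lemma exists_gap (P : Finset ℝ) {ψ : ℝ → ℝ → Prop} (hψ : ∀ r ∈ P, ∃ u, 0 < u ∧
    ∀ v, 0 ≤ v → v < u → ψ r v) : ∃ δ : ℝ, 0 < δ ∧
    (∀ r ∈ P, ∀ r' ∈ P, r < r' → δ ≤ r' - r) ∧ ∀ r ∈ P, ∀ v, 0 ≤ v → v ≤ δ → ψ r v := by
  have h1 : ∀ᶠ δ in nhdsWithin (0 : ℝ) (Ioi 0), ∀ r ∈ P, ∀ r' ∈ P, r < r' → δ ≤ r' - r := by
    simp only [Filter.eventually_all_finset]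
    intro r _ r' _
    by_cases h : r < r'
    · filter_upwards [Ioo_mem_nhdsGT (sub_pos.2 h)] with δ hδ _ using hδ.2.le
    · exact Eventually.of_forall fun δ h' => absurd h' h
  have h2 : ∀ᶠ δ in nhdsWithin (0 : ℝ) (Ioi 0), ∀ r ∈ P, ∀ v, 0 ≤ v → v ≤ δ → ψ r v := by
    rw [Filter.eventually_all_finset]
    intro r hr
    obtain ⟨u, hu, hv⟩ := hψ r hr
    filter_upwards [Ioo_mem_nhdsGT hu] with δ hδ v h0 h1 using hv v h0 (h1.trans_lt hδ.2)
  obtain ⟨δ, ⟨e1, e2⟩, e3⟩ := ((h1.and h2).and self_mem_nhdsWithin).exists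
  exact ⟨δ, e3, e1, e2⟩

theorem EulerLimit.exists_mesh_compSum_le (hE : EulerLimit p f g a z l w x0 n X Y σ x y) {T : ℝ}
    {H : ℕ → ℕ → Z →L[ℝ] E} {ζ : ℕ → ℕ → Z} {v : ℝ → Z} {K : ℝ}
    (hK : ∀ m j, j ≤ σ m T → ‖H m j‖ ≤ K)
    (hζ : ∀ η : ℝ, 0 < η → ∀ᶠ m in atTop, ∀ t : ℝ, 0 ≤ t → t ≤ T → ‖ζ m (σ m t) - v t‖ ≤ η)
    (hv : ∀ r : ℝ, ∀ η : ℝ, 0 < η → ∃ u, r < u ∧ ∀ t, r ≤ t → t < u → ‖v t - v r‖ ≤ η)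
    (hblock : ∀ ε : ℝ, 0 < ε → ∃ P : Finset ℝ, (∀ ρ ∈ P, 0 < ρ) ∧ ∀ᶠ m in atTop,
      (∀ r ∈ P, ∀ t : ℝ, 0 ≤ t → (r ≤ (σ m t : ℝ) / n m ↔ r ≤ t)) ∧
      ∃ C : ℕ → ℕ → ℝ, IsControl C ∧ C 0 (σ m T) ≤ ε ∧ ∀ b e, b ≤ e → e ≤ σ m T →
        (∀ j, b ≤ j → j < e → SameCell P ((b : ℝ) / n m) ((j : ℝ) / n m)) →
        ‖compSum (H m) (ζ m) b e‖ ≤ C b e)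
    {ε : ℝ} (hε : 0 < ε) : ∃ δ : ℝ, 0 < δ ∧ ∀ (N : ℕ) (u : ℕ → ℝ), Monotone u → u 0 = 0 →
      u N = T → (∀ i < N, u (i + 1) - u i ≤ δ) → ∀ᶠ m in atTop,
      ∑ i ∈ Finset.range N, ‖compSum (H m) (ζ m) (σ m (u i)) (σ m (u (i + 1)))‖ ≤ ε := by
  have hK0 : 0 ≤ K := (norm_nonneg _).trans (hK 0 0 (Nat.zero_le _))
  obtain ⟨P, hP0, hP⟩ := hblock (ε / 2) (half_pos hε)
  set η : ℝ := ε / 2 / (2 * K * 3 * P.card + 1) with hη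
  have hη0 : 0 < η := by positivity
  obtain ⟨δ, hδ, hgap, hosc⟩ := exists_gap P (ψ := fun r s => ‖v (r + s) - v r‖ ≤ η) fun r hr => by
    obtain ⟨u, hu, huv⟩ := hv r η hη0
    exact ⟨u - r, by linarith, fun s h1 h2 => huv _ (by linarith) (by linarith)⟩
  refine ⟨δ, hδ, fun N u hmono h0 hN hmesh => ?_⟩
  filter_upwards [hP, hζ η hη0] with m h1 h2
  obtain ⟨halign, C, hC, hCε, hCb⟩ := h1
  have hvm : Monotone fun i => σ m (u i) := (hE.idx_mono m).comp hmono
  have hu0 : ∀ i, 0 ≤ u i := fun i => h0 ▸ hmono (Nat.zero_le i)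
  have huT : ∀ i ≤ N, u i ≤ T := fun i hi => hN ▸ hmono hi
  calc _ ≤ ∑ i ∈ Finset.range N, (C (σ m (u i)) (σ m (u (i + 1))) +
        2 * K * (3 * η) * (cellIndex P (u (i + 1)) - cellIndex P (u i))) := by
        refine Finset.sum_le_sum fun i hi => ?_
        have hi := Finset.mem_range.1 hi
        have hle := hmono (Nat.le_succ i)
        have hσT : σ m (u (i + 1)) ≤ σ m T := hE.idx_mono m (huT (i + 1) hi)
        refine norm_compSum_le_of_gap (ν := n m) (hE.idx_mono m)
          (fun h3 h4 => hE.idx_surj m (hu0 i) hle h3 h4) (hu0 i) hle (hmesh i hi) hgap halign hC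
          (fun j hj => hK m j (hj.trans hσT)) (by positivity) (fun r hr h3 h4 => ?_)
          fun b e h3 h4 => hCb b e h3 (h4.trans hσT)
        have e1 := h2 (u (i + 1)) (hu0 _) (huT _ hi)
        have e2 := h2 r ((hu0 i).trans h3.le) (h4.trans (huT _ hi))
        have e3 := hosc r hr (u (i + 1) - r) (by linarith) (by linarith [hmesh i hi])
        rw [add_sub_cancel] at e3
        have e4 : ζ m (σ m (u (i + 1))) - ζ m (σ m r) = (ζ m (σ m (u (i + 1))) - v (u (i + 1))) +
            (v (u (i + 1)) - v r) + (v r - ζ m (σ m r)) := by abel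
        rw [norm_sub_rev] at e2
        rw [e4]
        exact norm_add₃_le.trans (by linarith)
    _ = ∑ i ∈ Finset.range N, C (σ m (u i)) (σ m (u (i + 1))) +
        2 * K * (3 * η) * (cellIndex P (u N) - cellIndex P (u 0)) := by
        rw [Finset.sum_add_distrib, ← Finset.mul_sum,
          Finset.sum_range_sub fun i => (cellIndex P (u i) : ℝ)]
    _ ≤ C 0 (σ m T) + 2 * K * (3 * η) * P.card := by
        have e1 := hC.sum_le hvm N
        rw [h0, hN, hE.idx_zero] at e1
        have e2 : (cellIndex P (u N) : ℝ) ≤ P.card := by exact_mod_cast cellIndex_le_card P _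
        have e3 : (0 : ℝ) ≤ cellIndex P (u 0) := Nat.cast_nonneg _
        have e4 : (cellIndex P (u N) - cellIndex P (u 0) : ℝ) ≤ P.card := by linarith
        exact add_le_add e1 (mul_le_mul_of_nonneg_left e4 (by positivity))
    _ ≤ ε / 2 + ε / 2 := by
        refine add_le_add hCε ?_
        have : 2 * K * (3 * η) * P.card = (2 * K * 3 * P.card) * η := by ring
        rw [this, hη, mul_div_assoc', div_le_iff₀ (by positivity)]
        nlinarith
    _ = ε := by ring

end SmallCompensatedSums

section LimitEquation

variable {d : ℕ} {p α L Cα : ℝ} {f : Eu d → Eu d} {g : Eu d → (Eu d →L[ℝ] Eu d)}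
  {a : ℝ → ℝ} {z l : ℝ → Eu d} {w : ℝ → ℝ → ℝ} {x0 : Eu d} {n : ℕ → ℕ}
  {X Y : ℕ → ℕ → Eu d} {σ : ℕ → ℝ → ℕ} {x y : ℝ → Eu d}

namespace EulerLimit

variable (hE : EulerLimit p f g a z l w x0 n X Y σ x y)
include hE

lemma div_le_ceil {T : ℝ} (hT : 0 ≤ T) {m j : ℕ} (hj : j ≤ σ m T) :
    (j : ℝ) / n m ≤ ((⌈T⌉₊ + 1 : ℕ) : ℝ) := by
  have h1 : (j : ℝ) / n m ≤ (σ m T : ℝ) / n m := by gcongr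
  push_cast
  linarith [hE.idx_le m hT, Nat.le_ceil T]

theorem exists_isRSInt_g (hc : IsCoeff p α L Cα f g) (hD : IsDriver p a z l w)
    (hz : Cadlag z) {T : ℝ} (hT : 0 ≤ T) : ∃ I : Eu d,
    Tendsto (fun m => ∑ j ∈ Finset.range (σ m T),
      g (X m j) (z (((j + 1 : ℕ) : ℝ) / n m) - z ((j : ℝ) / n m))) atTop (nhds I) ∧
    IsRSInt (fun (A : Eu d →L[ℝ] Eu d) (v : Eu d) => A v) (fun s => g (x s)) z 0 T I := by
  have hp1 := hc.one_le
  have hp0 : 0 < p := by linarith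
  have hα0 : 0 < α := by linarith [hc.lt_exp]
  have hgc : Continuous g := by
    rw [continuous_iff_continuousAt]
    intro v
    rw [ContinuousAt, tendsto_iff_norm_sub_tendsto_zero]
    have h1 : Tendsto (fun u : Eu d => Cα * ‖u - v‖ ^ α) (nhds v) (nhds 0) := by
      have h2 : Continuous fun u : Eu d => Cα * ‖u - v‖ ^ α :=
        continuous_const.mul ((continuous_id.sub continuous_const).norm.rpow_const
          fun _ => Or.inr hα0.le)
      simpa [Real.zero_rpow hα0.ne'] using h2.tendsto v
    exact squeeze_zero (fun _ => norm_nonneg _) (fun u => hc.holder u v) h1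
  obtain ⟨M, B, Ω, hΩ, hP⟩ := hE.bounds (⌈T⌉₊ + 1)
  have hB : 0 ≤ B := ((hΩ 0).ctrl.nonneg le_rfl).trans
    ((hΩ 0).total 0 (by rw [Nat.cast_zero, zero_div]; positivity))
  have hW : 0 ≤ w 0 (T + 1) := hD.ctrl.nonneg le_rfl (by linarith)
  have hY := youngConst_nonneg hp1 hc.lt_exp
  set Q : ℝ := 2 / (1 - 2 ^ (1 - (α / p + 1 / p)))
  have hCα := hc.pos_C
  have hr0 : 0 ≤ 1 / p := by positivity
  have hr1 : 0 ≤ 1 - 1 / p := sub_nonneg.2 (by rw [div_le_one hp0]; exact hp1)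
  have hβγ : 1 < α / p + 1 / p := by
    rw [← add_div, lt_div_iff₀ hp0]
    linarith [hc.lt_exp]
  set θ : ℝ := α / p - (1 - 1 / p) with hθ
  have hθ0 : 0 < θ := by linarith
  refine exists_isRSInt_of_compSum hT hE.idx_mono hE.idx_zero (H := fun m j => g (X m j))
    (ζ := fun m j => z ((j : ℝ) / n m))
    (fun t h0 _ => (hgc.tendsto _).comp (hE.tendsto_X h0))
    (fun t h0 _ => (hE.tendsto_drivers hp0 hD h0).2.1) fun ε hε =>
    hE.exists_mesh_compSum_le (v := z) (K := (‖g 0‖ + Cα) * (1 + M)) (fun m j hj => ?_)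
      (fun η hη => ?_) (fun r η hη => ?_) (fun ε hε => ?_) hε
  · refine (norm_coeff_le hα0.le hc.exp_le hCα.le hc.holder _).trans ?_
    have := (hΩ m).norm_x j (hE.div_le_ceil hT hj)
    gcongr
  · filter_upwards [hE.near hp0 hD ⌈T⌉₊ hη] with m hm t h0 h1 using
      (hm t h0 (h1.trans (Nat.le_ceil T))).2.1
  · obtain ⟨u, hu, hur⟩ := hz.exists_right_small r hη
    exact ⟨u, hu, fun t h1 h2 => hur r t le_rfl h1 h2⟩
  · set A : ℝ := Q * Cα * (B ^ (1 - 1 / p) * w 0 (T + 1) ^ (1 / p)) with hA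
    have hA0 : 0 ≤ A := by positivity
    set η : ℝ := (ε / (A + 1)) ^ (1 / θ) with hη
    have hη0 : 0 < η := by positivity
    have hηθ : η ^ θ = ε / (A + 1) := by
      rw [hη, ← Real.rpow_mul (by positivity), one_div_mul_cancel hθ0.ne', Real.rpow_one]
    obtain ⟨P, hP0, -, hPe⟩ := hP η hη0
    refine ⟨P, hP0, ?_⟩
    filter_upwards [hPe] with m hm
    have hcw := hD.ctrl.grid (n m)
    have hctrl := ((hΩ m).ctrl.rpow_mul_rpow hcw hr1 hr0 (by ring)).const_mul
      (r := Q * Cα * η ^ θ) (by positivity)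
    refine ⟨hm.2, _, hctrl, ?_, fun b e hbe he hcell => ?_⟩
    · have e1 := (hΩ m).total _ (hE.div_le_ceil hT (le_refl (σ m T)))
      have e2 : w (((0 : ℕ) : ℝ) / n m) ((σ m T : ℝ) / n m) ≤ w 0 (T + 1) :=
        hD.ctrl.mono le_rfl (by simp) (by rw [Nat.cast_zero, zero_div]; positivity)
          (hE.idx_le m hT)
      have e3 := (hΩ m).ctrl.nonneg (Nat.zero_le (σ m T))
      have e4 := hcw.nonneg (Nat.zero_le (σ m T))
      calc _ ≤ Q * Cα * η ^ θ * (B ^ (1 - 1 / p) * w 0 (T + 1) ^ (1 / p)) := by gcongr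
        _ = A * ε / (A + 1) := by rw [hηθ, hA]; ring
        _ ≤ ε := by
          rw [div_le_iff₀ (by positivity)]
          linarith
    · rcases hbe.eq_or_lt with rfl | hlt
      · have := hctrl.nonneg hbe
        simpa [compSum] using this
      · have hmin : ∀ j, j < e → min j (e - 1) = j := fun j hj => by omega
        have hω : IsControl fun i j => Ω m (min i (e - 1)) (min j (e - 1)) :=
          (hΩ m).ctrl.comp (u := fun i => min i (e - 1)) fun i j hij => by
            dsimp only
            omega
        have h1 := norm_compSum_le_young hω hcw (β := α / p) (γ := 1 / p) (D := Cα)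
          (by positivity) (by positivity) hβγ hCα.le (fun j => g (X m j))
          (fun j => z ((j : ℝ) / n m)) e b (fun i j h1 h2 h3 => ?_)
          (fun j k h1 h2 h3 => hD.norm_z (by positivity) (by gcongr)) b e le_rfl hbe le_rfl
        · have h2 := (hm.1 b (e - 1) (by omega)
            (hE.div_le_ceil hT ((Nat.sub_le _ _).trans he)) (hcell _ (by omega) (by omega))).1
          have h3 := (hΩ m).ctrl.nonneg (show b ≤ e - 1 by omega)
          have h4 := (hΩ m).ctrl.mono (le_refl b) (show b ≤ e - 1 by omega) (Nat.sub_le e 1)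
          have h5 := hcw.nonneg hbe
          rw [hmin b hlt, show min e (e - 1) = e - 1 by omega] at h1
          have h6 : Ω m b (e - 1) ^ (α / p) ≤ η ^ θ * Ω m b e ^ (1 - 1 / p) := by
            rw [show α / p = θ + (1 - 1 / p) by rw [hθ]; ring,
              Real.rpow_add_of_nonneg h3 hθ0.le hr1]
            gcongr
          calc _ ≤ Q * Cα * (Ω m b (e - 1) ^ (α / p) *
                w ((b : ℝ) / n m) ((e : ℝ) / n m) ^ (1 / p)) := h1
            _ ≤ Q * Cα * ((η ^ θ * Ω m b e ^ (1 - 1 / p)) *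
                w ((b : ℝ) / n m) ((e : ℝ) / n m) ^ (1 / p)) := by gcongr
            _ = _ := by ring
        · rw [hmin j h3, hmin i (by omega)]
          refine (hc.holder _ _).trans (mul_le_mul_of_nonneg_left ?_ hCα.le)
          have h4 := (hΩ m).norm_x_sub i j h2 (hE.div_le_ceil hT (h3.le.trans he))
          calc _ ≤ (Ω m i j ^ (1 / p)) ^ α := by gcongr
            _ = _ := by
              rw [← Real.rpow_mul ((hΩ m).ctrl.nonneg h2)]
              congr 1
              ring

theorem exists_isRSInt_f (hc : IsCoeff p α L Cα f g) (hD : IsDriver p a z l w)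
    (ha : Cadlag a) {T : ℝ} (hT : 0 ≤ T) : ∃ I : Eu d,
    Tendsto (fun m => ∑ j ∈ Finset.range (σ m T),
      (a (((j + 1 : ℕ) : ℝ) / n m) - a ((j : ℝ) / n m)) • f (X m j)) atTop (nhds I) ∧
    IsRSInt (fun (v : Eu d) (r : ℝ) => r • v) (fun s => f (x s)) a 0 T I := by
  have hp1 := hc.one_le
  have hp0 : 0 < p := by linarith
  have hL := hc.pos_L
  obtain ⟨G, hGr, hGc, hGn, hGsub⟩ : ∃ G : Eu d → ℝ →L[ℝ] Eu d, (∀ v r, G v r = r • f v) ∧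
      Continuous G ∧ (∀ v, ‖G v‖ = ‖f v‖) ∧ ∀ u v, ‖G u - G v‖ = ‖f u - f v‖ :=
    ⟨fun v => ContinuousLinearMap.toSpanSingletonLIE ℝ (Eu d) (f v), fun v r => rfl,
      (ContinuousLinearMap.toSpanSingletonLIE ℝ (Eu d)).continuous.comp hc.cont,
      fun v => LinearIsometryEquiv.norm_map _ _,
      fun u v => by rw [← map_sub, LinearIsometryEquiv.norm_map]⟩
  obtain ⟨M, B, Ω, hΩ, hP⟩ := hE.bounds (⌈T⌉₊ + 1)
  have hW : 0 ≤ w 0 (T + 1) := hD.ctrl.nonneg le_rfl (by linarith)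
  suffices h : ∃ I : Eu d, Tendsto (fun m => ∑ j ∈ Finset.range (σ m T),
      G (X m j) (a (((j + 1 : ℕ) : ℝ) / n m) - a ((j : ℝ) / n m))) atTop (nhds I) ∧
      IsRSInt (fun (A : ℝ →L[ℝ] Eu d) (v : ℝ) => A v) (fun s => G (x s)) a 0 T I by
    simpa only [IsRSInt, hGr] using h
  refine exists_isRSInt_of_compSum hT hE.idx_mono hE.idx_zero (H := fun m j => G (X m j))
    (ζ := fun m j => a ((j : ℝ) / n m))
    (fun t h0 _ => (hGc.tendsto _).comp (hE.tendsto_X h0))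
    (fun t h0 _ => (hE.tendsto_drivers hp0 hD h0).1) fun ε hε =>
    hE.exists_mesh_compSum_le (v := a) (K := L * (1 + M)) (fun m j hj => ?_)
      (fun η hη => ?_) (fun r η hη => ?_) (fun ε hε => ?_) hε
  · have := (hΩ m).norm_x j (hE.div_le_ceil hT hj)
    rw [hGn]
    refine (hc.growth _).trans ?_
    gcongr
  · filter_upwards [hE.near hp0 hD ⌈T⌉₊ hη] with m hm t h0 h1 using
      (hm t h0 (h1.trans (Nat.le_ceil T))).1
  · obtain ⟨u, hu, hur⟩ := ha.exists_right_small r hη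
    exact ⟨u, hu, fun t h1 h2 => hur r t le_rfl h1 h2⟩
  · set κ : ℝ := ε / (w 0 (T + 1) + 1) with hκ
    have hκ0 : 0 < κ := by positivity
    obtain ⟨δ, hδ, hδf⟩ := Metric.uniformContinuousOn_iff_le.1
      ((isCompact_closedBall (0 : Eu d) M).uniformContinuousOn_of_continuous hc.cont.continuousOn)
      κ hκ0
    obtain ⟨P, hP0, -, hPe⟩ := hP (δ ^ p) (by positivity)
    refine ⟨P, hP0, ?_⟩
    filter_upwards [hPe] with m hm
    have hcw := hD.ctrl.grid (n m)
    have hctrl := hcw.const_mul hκ0.le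
    refine ⟨hm.2, _, hctrl, ?_, fun b e hbe he hcell => ?_⟩
    · have e2 : w (((0 : ℕ) : ℝ) / n m) ((σ m T : ℝ) / n m) ≤ w 0 (T + 1) :=
        hD.ctrl.mono le_rfl (by simp) (by rw [Nat.cast_zero, zero_div]; positivity)
          (hE.idx_le m hT)
      calc _ ≤ κ * w 0 (T + 1) := by gcongr
        _ = w 0 (T + 1) * ε / (w 0 (T + 1) + 1) := by rw [hκ]; ring
        _ ≤ ε := by
          rw [div_le_iff₀ (by positivity)]
          linarith
    · calc _ ≤ ∑ j ∈ Finset.Ico b e, κ * w ((j : ℝ) / n m) (((j + 1 : ℕ) : ℝ) / n m) := by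
            refine (norm_sum_le _ _).trans (Finset.sum_le_sum fun j hj => ?_)
            obtain ⟨h1, h2⟩ := Finset.mem_Ico.1 hj
            have hjT := hE.div_le_ceil hT (h2.le.trans he)
            refine (ContinuousLinearMap.le_opNorm _ _).trans
              (mul_le_mul ?_ (hD.abs_a (by positivity) (by gcongr; omega)) (norm_nonneg _) hκ0.le)
            rw [hGsub, ← dist_eq_norm]
            refine hδf _ ?_ _ ?_ ?_
            · simpa using (hΩ m).norm_x j hjT
            · simpa using (hΩ m).norm_x b (hE.div_le_ceil hT (hbe.trans he))
            · rw [dist_eq_norm]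
              calc _ ≤ Ω m b j ^ (1 / p) := (hΩ m).norm_x_sub b j h1 hjT
                _ ≤ (δ ^ p) ^ (1 / p) := Real.rpow_le_rpow ((hΩ m).ctrl.nonneg h1)
                    (hm.1 b j h1 hjT (hcell j h1 h2)).1 (by positivity)
                _ = δ := by
                    rw [← Real.rpow_mul hδ.le, mul_one_div_cancel hp0.ne', Real.rpow_one]
        _ ≤ κ * w ((b : ℝ) / n m) ((e : ℝ) / n m) := by
            rw [← Finset.mul_sum]
            exact mul_le_mul_of_nonneg_left (hcw.sum_Ico_le hbe) hκ0.le

lemma isSolution (hc : IsCoeff p α L Cα f g) (hD : IsDriver p a z l w) (ha : Cadlag a)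
    (hz : Cadlag z) : IsSolution d p f g a z l x0 x (fun t => x t - y t) := by
  have hp0 : 0 < p := by linarith [hc.one_le]
  refine ⟨fun T _ => hE.hasFinVar hp0 T, ?_⟩
  choose! If hIf hIf' using fun (t : ℝ) (ht : 0 ≤ t) => hE.exists_isRSInt_f hc hD ha ht
  choose! Ig hIg hIg' using fun (t : ℝ) (ht : 0 ≤ t) => hE.exists_isRSInt_g hc hD hz ht
  refine ⟨If, Ig, ?_, ?_, hIf', hIg', hE.isSP hp0 hD fun t ht => ?_⟩
  · refine tendsto_nhds_unique (hIf 0 le_rfl) ?_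
    simp only [hE.idx_zero, Finset.range_zero, Finset.sum_empty]
    exact tendsto_const_nhds
  · refine tendsto_nhds_unique (hIg 0 le_rfl) ?_
    simp only [hE.idx_zero, Finset.range_zero, Finset.sum_empty]
    exact tendsto_const_nhds
  · refine tendsto_nhds_unique ?_ (hE.tendsto_Y ht)
    refine ((tendsto_const_nhds.add (hIf t ht)).add (hIg t ht)).congr fun m => ?_
    have h := (hE.euler m).y_sub (Nat.zero_le (σ m t))
    rw [(hE.euler m).y_zero, hE.x_start, ← Finset.range_eq_Ico] at h
    rw [add_assoc, ← sub_eq_iff_eq_add'.1 h]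

end EulerLimit

end LimitEquation

section Assembly

variable {d : ℕ} {p : ℝ} {f : Eu d → Eu d} {g : Eu d → (Eu d →L[ℝ] Eu d)}
  {a : ℝ → ℝ} {z l : ℝ → Eu d} {x0 : Eu d}

lemma isGridEuler_eulerX (h0 : ∀ i : Fin d, l 0 i ≤ x0 i) (n : ℕ) :
    IsGridEuler f g a z l n (eulerX d f g a z l x0 n)
      (fun k => x0 + ∑ j ∈ Finset.range k, eulerDy d f g a z n (eulerX d f g a z l x0 n j) j) where
  y_zero := by simp [eulerX]
  y_succ j := by
    rw [Finset.sum_range_succ, ← add_assoc]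
    simp only [eulerDy, Nat.cast_add, Nat.cast_one]
  x_succ j i := by
    have h : ∀ u v : Eu d, u i + v i = (u + v) i := fun u v => rfl
    simp only [eulerX, Finset.sum_range_succ, ← add_assoc, Nat.cast_add, Nat.cast_one]
    simp
  l_zero i := by simpa [eulerX] using h0 i

lemma tendsto_iSup_Icc_of_eventually_le {F : ℕ → ℝ → ℝ} {T : ℝ} (hF : ∀ m t, 0 ≤ F m t)
    (h : ∀ η : ℝ, 0 < η → ∀ᶠ m in atTop, ∀ t : ℝ, 0 ≤ t → t ≤ T → F m t ≤ η) :
    Tendsto (fun m => ⨆ t : Icc (0 : ℝ) T, F m t) atTop (nhds 0) := by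
  rw [Metric.tendsto_nhds]
  intro ε hε
  filter_upwards [h (ε / 2) (half_pos hε)] with m hm
  rw [Real.dist_0_eq_abs, abs_of_nonneg (Real.iSup_nonneg fun t : Icc (0 : ℝ) T => hF m t)]
  exact (Real.iSup_le (fun t : Icc (0 : ℝ) T => hm t t.2.1 t.2.2) (half_pos hε).le).trans_lt
    (half_lt_self hε)

end Assembly

theorem existence_constrained_equation (d : ℕ) (p α L Cα : ℝ)
    (hp : 1 ≤ p) (hα1 : p - 1 < α) (hα2 : α ≤ 1) (hL : 0 < L) (hCα : 0 < Cα)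
    (f : Eu d → Eu d) (g : Eu d → (Eu d →L[ℝ] Eu d))
    (hfc : Continuous f) (hflin : ∀ u : Eu d, ‖f u‖ ≤ L * (1 + ‖u‖))
    (hg : ∀ u v : Eu d, ‖g u - g v‖ ≤ Cα * ‖u - v‖ ^ α)
    (a : ℝ → ℝ) (z l : ℝ → Eu d) (x0 : Eu d)
    (ha : Cadlag a) (hz : Cadlag z) (hl : Cadlag l)
    (hav : ∀ T : ℝ, 0 ≤ T → HasFinVar 1 a 0 T)
    (hzv : ∀ T : ℝ, 0 ≤ T → HasFinVar p z 0 T)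
    (h0 : ∀ i : Fin d, l 0 i ≤ x0 i) :
    ∃ (x k : ℝ → Eu d) (φ : ℕ → ℕ), StrictMono φ ∧
      IsSolution d p f g a z l x0 x k ∧
      J1Tendsto
        (fun m => fun t => (eulerXproc d f g a z l x0 (φ m) t,
                            eulerKproc d f g a z l x0 (φ m) t))
        (fun t => (x t, k t)) := by
  have hc : IsCoeff p α L Cα f g := ⟨hp, hα1, hα2, hL, hCα, hfc, hflin, hg⟩
  obtain ⟨w, hD⟩ := exists_isDriver hp ha hz hl hav hzv
  obtain ⟨n, lam, x, y, hn, hmono, hsurj, hzero, hclose, hE⟩ :=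
    exists_eulerLimit hc hD x0 (isGridEuler_eulerX h0) fun _ => rfl
  refine ⟨x, fun t => x t - y t, n, hn, hE.isSolution hc hD ha hz, lam, hmono, hsurj, hzero,
    fun T _ => ⟨tendsto_iSup_Icc_of_eventually_le (F := fun m t => |lam m t - t|)
        (fun _ _ => abs_nonneg _) fun η hη => ?_,
      tendsto_iSup_Icc_of_eventually_le (F := fun m t =>
        ‖((eulerXproc d f g a z l x0 (n m) (lam m t), eulerKproc d f g a z l x0 (n m) (lam m t)) :
          Eu d × Eu d) - (x t, x t - y t)‖) (fun _ _ => norm_nonneg _) fun η hη => ?_⟩⟩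
  · obtain ⟨N, hN⟩ := exists_nat_one_div_lt hη
    filter_upwards [eventually_ge_atTop N] with m hm t _ _
    refine (hclose m t).trans (le_trans ?_ hN.le)
    gcongr
  · filter_upwards [hE.lim ⌈T⌉₊ (η / 2) (half_pos hη)] with m hm t h1 h2
    obtain ⟨e1, e2⟩ := hm t h1 (h2.trans (Nat.le_ceil T))
    have e3 := (norm_sub_le _ _).trans (add_le_add e1 e2)
    rw [add_halves] at e3
    have e4 : eulerKproc d f g a z l x0 (n m) (lam m t) - (x t - y t) =
        (eulerX d f g a z l x0 (n m) (gridIdx (n m) (lam m) t) - x t) -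
          (x0 + ∑ j ∈ Finset.range (gridIdx (n m) (lam m) t),
            eulerDy d f g a z (n m) (eulerX d f g a z l x0 (n m) j) j - y t) := by
      unfold eulerKproc eulerK gridIdx
      abel
    rw [Prod.mk_sub_mk, e4]
    exact norm_prod_le_iff.2 ⟨e1.trans (half_le_self hη.le), e3⟩
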